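/- The first-return map H_S of the linked-twist map H to the square S preserves the measure μ.restrict S (which is a probability measure, since μ(S) = 1) and is ergodic with respect to it: MeasurePreserving H_S (μ.restrict S) (μ.restrict S) and Ergodic H_S (μ.restrict S). -/

import Mathlib

open MeasureTheory
open scoped NNReal ENNReal

noncomputable section

instance : Fact ((0:ℝ) < 2) := ⟨by norm_num⟩

/-- The torus, as a product of two circles of circumference 2. -/
abbrev 𝕋 : Type := AddCircle (2:ℝ) × AddCircle (2:ℝ)

/-- The unique representative in `[0, 2)` of a point of the circle. -/
def θ (x : AddCircle (2:ℝ)) : ℝ := ((AddCircle.equivIco 2 0) x : ℝ)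

def P : Set 𝕋 := {z | θ z.2 ≤ 1}
def Q : Set 𝕋 := {z | θ z.1 ≤ 1}
def R : Set 𝕋 := P ∪ Q
def S : Set 𝕋 := P ∩ Q

/-- The horizontal twist map. -/
def F (z : 𝕋) : 𝕋 :=
  if θ z.2 ≤ 1 then (z.1 + (((2 * θ z.2 : ℝ) : AddCircle (2:ℝ))), z.2) else z

/-- The vertical twist map. -/
def G (z : 𝕋) : 𝕋 :=
  if θ z.1 ≤ 1 then (z.1, z.2 + (((2 * θ z.1 : ℝ) : AddCircle (2:ℝ)))) else z

/-- The linked-twist map. -/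
def H : 𝕋 → 𝕋 := G ∘ F

/-- The first-return time of `T` to `S`. -/
def rtn (T : 𝕋 → 𝕋) (z : 𝕋) : ℕ := sInf {n : ℕ | 1 ≤ n ∧ T^[n] z ∈ S}

/-- The first-return map of `T` to `S`. -/
def retMap (T : 𝕋 → 𝕋) (z : 𝕋) : 𝕋 := T^[rtn T z] z

/-- The set of points of `S` with return time exactly `n`. -/
def Sn (n : ℕ) : Set 𝕋 := {z | z ∈ S ∧ rtn H z = n}

open Filter Topology

/-- A lift to the line of the twist profile. -/
def shear (y : ℝ) : ℝ := if Even ⌊y⌋ then 2 * y - ⌊y⌋ else ⌊y⌋ + 1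

/-- The slope of `shear` on the unit interval containing `y`. -/
def slo (y : ℝ) : ℝ := if Even ⌊y⌋ then 2 else 0

/-- The distance to the nearest integer. -/
def kap (y : ℝ) : ℝ := min (Int.fract y) (1 - Int.fract y)

/-- `y` lies in the interior of the twisting band, at distance at least `ε` from its boundary. -/
def Act (ε y : ℝ) : Prop := Even ⌊y⌋ ∧ ε ≤ kap y

lemma shear_of_even {y : ℝ} {i : ℤ} (h : ⌊y⌋ = i) (hi : Even i) : shear y = 2 * y - i := by
  subst h; simp [shear, hi]

lemma shear_of_odd {y : ℝ} {i : ℤ} (h : ⌊y⌋ = i) (hi : Odd i) : shear y = i + 1 := by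
  subst h; simp [shear, Int.not_even_iff_odd.2 hi]

lemma shear_sub_self_mem (y : ℝ) : 0 ≤ shear y - y ∧ shear y - y ≤ 1 := by
  have h1 := Int.floor_le y
  have h2 := Int.lt_floor_add_one y
  unfold shear
  split_ifs <;> constructor <;> linarith

lemma shear_sub_mem {y y' : ℝ} (h : y ≤ y') :
    0 ≤ shear y' - shear y ∧ shear y' - shear y ≤ 2 * (y' - y) := by
  have h1 := Int.floor_le y
  have h2 := Int.lt_floor_add_one y
  have h3 := Int.floor_le y'
  have h4 := Int.lt_floor_add_one y'
  have h5 := Int.floor_le_floor h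
  obtain ⟨i, hi⟩ : ∃ i, ⌊y⌋ = i := ⟨_, rfl⟩
  obtain ⟨j, hj⟩ : ∃ j, ⌊y'⌋ = j := ⟨_, rfl⟩
  rw [hi] at h1 h2 h5
  rw [hj] at h3 h4 h5
  rcases Int.even_or_odd i with ei | ei <;> rcases Int.even_or_odd j with ej | ej
  · rw [shear_of_even hi ei, shear_of_even hj ej]
    obtain ⟨k, rfl⟩ := ei
    obtain ⟨l, rfl⟩ := ej
    have : (k : ℝ) ≤ l := by exact_mod_cast (by omega : k ≤ l)
    push_cast at *
    rcases eq_or_lt_of_le this with h | h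
    · constructor <;> linarith
    · have : (k : ℝ) + 1 ≤ l := by exact_mod_cast h
      constructor <;> linarith
  · rw [shear_of_even hi ei, shear_of_odd hj ej]
    obtain ⟨k, rfl⟩ := ei
    obtain ⟨l, rfl⟩ := ej
    have : (k : ℝ) ≤ l := by exact_mod_cast (by omega : k ≤ l)
    push_cast at *
    constructor <;> linarith
  · rw [shear_of_odd hi ei, shear_of_even hj ej]
    obtain ⟨k, rfl⟩ := ei
    obtain ⟨l, rfl⟩ := ej
    have : (k : ℝ) + 1 ≤ l := by exact_mod_cast (by omega : k + 1 ≤ l)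
    push_cast at *
    constructor <;> linarith
  · rw [shear_of_odd hi ei, shear_of_odd hj ej]
    obtain ⟨k, rfl⟩ := ei
    obtain ⟨l, rfl⟩ := ej
    have : (k : ℝ) ≤ l := by exact_mod_cast (by omega : k ≤ l)
    push_cast at *
    rcases eq_or_lt_of_le this with h | h
    · constructor <;> linarith
    · have : (k : ℝ) + 1 ≤ l := by exact_mod_cast h
      constructor <;> linarith

lemma shear_mono : Monotone shear := fun _ _ h => by linarith [(shear_sub_mem h).1]

lemma lipschitzWith_shear : LipschitzWith 2 shear := by
  refine LipschitzWith.of_dist_le_mul fun x y => ?_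
  rw [Real.dist_eq, Real.dist_eq]
  rcases le_total x y with h | h
  · have := shear_sub_mem h
    rw [abs_sub_comm, abs_of_nonneg this.1, abs_sub_comm, abs_of_nonneg (sub_nonneg.2 h)]
    exact this.2
  · have := shear_sub_mem h
    rw [abs_of_nonneg this.1, abs_of_nonneg (sub_nonneg.2 h)]
    exact this.2

@[fun_prop]
lemma continuous_shear : Continuous shear := lipschitzWith_shear.continuous

lemma two_mul_min_le_shear_sub {ε u v : ℝ} (h : u ≤ v) (ha : Act ε u ∨ Act ε v) :
    2 * min (v - u) ε ≤ shear v - shear u := by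
  rcases ha with ⟨he, hk⟩ | ⟨he, hk⟩
  · have hk' : ε ≤ 1 - (u - ⌊u⌋) := hk.trans (min_le_right _ _)
    by_cases hv : v < ⌊u⌋ + 1
    · have : ⌊v⌋ = ⌊u⌋ := Int.floor_eq_iff.2 ⟨(Int.floor_le u).trans h, hv⟩
      rw [shear_of_even this he, shear_of_even rfl he]
      linarith [min_le_left (v - u) ε]
    · have h1 := shear_mono (not_lt.1 hv)
      have h2 : shear ((⌊u⌋ : ℝ) + 1) = ⌊u⌋ + 2 := by
        rw [shear_of_odd (i := ⌊u⌋ + 1) (by simp) he.add_one]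
        push_cast; ring
      rw [h2] at h1
      rw [shear_of_even rfl he]
      linarith [min_le_right (v - u) ε]
  · have hk' : ε ≤ v - ⌊v⌋ := hk.trans (min_le_left _ _)
    by_cases hu : ⌊v⌋ ≤ u
    · have : ⌊u⌋ = ⌊v⌋ := Int.floor_eq_iff.2 ⟨hu, h.trans_lt (Int.lt_floor_add_one v)⟩
      rw [shear_of_even this he, shear_of_even rfl he]
      linarith [min_le_left (v - u) ε]
    · have h1 := shear_mono (not_le.1 hu).le
      have h2 : shear (⌊v⌋ : ℝ) = ⌊v⌋ := by
        rw [shear_of_even (i := ⌊v⌋) (by simp) he]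
        ring
      rw [h2] at h1
      rw [shear_of_even rfl he]
      linarith [min_le_right (v - u) ε]

lemma floor_eq_of_abs_lt_kap {c d : ℝ} (h : |d - c| < kap c) : ⌊d⌋ = ⌊c⌋ := by
  have h1 : |d - c| < c - ⌊c⌋ := h.trans_le (min_le_left _ _)
  have h2 : |d - c| < 1 - (c - ⌊c⌋) := h.trans_le (min_le_right _ _)
  rw [abs_lt] at h1 h2
  exact Int.floor_eq_iff.2 ⟨by linarith, by linarith⟩

lemma shear_sub_eq_slo_mul {c d : ℝ} (h : ⌊d⌋ = ⌊c⌋) : shear d - shear c = slo c * (d - c) := by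
  unfold slo shear
  rw [h]
  split_ifs <;> ring

/-- The lift of the linked-twist map to the plane. -/
def Ht (z : ℝ × ℝ) : ℝ × ℝ := (z.1 + shear z.2, z.2 + shear (z.1 + shear z.2))

lemma Ht_fst (z : ℝ × ℝ) : (Ht z).1 = z.1 + shear z.2 := rfl

lemma Ht_snd (z : ℝ × ℝ) : (Ht z).2 = z.2 + shear (Ht z).1 := rfl

@[fun_prop]
lemma continuous_Ht : Continuous Ht := by unfold Ht; fun_prop

lemma Ht_mono : Monotone Ht := fun z w h => by
  have h1 : (Ht z).1 ≤ (Ht w).1 := by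
    rw [Ht_fst, Ht_fst]; linarith [h.1, shear_mono h.2]
  exact ⟨h1, by rw [Ht_snd, Ht_snd]; linarith [h.2, shear_mono h1]⟩

lemma iterate_Ht_fst (n : ℕ) (z : ℝ × ℝ) :
    (Ht^[n + 1] z).1 = (Ht^[n] z).1 + shear (Ht^[n] z).2 := by
  rw [Function.iterate_succ_apply', Ht_fst]

lemma iterate_Ht_snd (n : ℕ) (z : ℝ × ℝ) :
    (Ht^[n + 1] z).2 = (Ht^[n] z).2 + shear (Ht^[n + 1] z).1 := by
  rw [Function.iterate_succ_apply', Ht_snd]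

/-- The linear functional expanded by the homology action of the linked-twist map. -/
def ell (z : ℝ × ℝ) : ℝ := z.1 + Real.goldenRatio * z.2

/-- The expansion rate of the homology action. -/
def lam : ℝ := Real.goldenRatio + 1

/-- The defect of `ell` from being an eigenfunction. -/
def defect (z : ℝ × ℝ) : ℝ := ell (Ht z) - lam * ell z

lemma lam_gt_one : 1 < lam := by
  have := Real.goldenRatio_pos
  unfold lam; linarith

lemma lam_pos : 0 < lam := zero_lt_one.trans lam_gt_one

lemma abs_defect_le (z : ℝ × ℝ) : |defect z| ≤ 1 + 2 * Real.goldenRatio := by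
  have h1 := shear_sub_self_mem z.2
  have h2 := shear_sub_self_mem (Ht z).1
  have hg := Real.goldenRatio_pos
  have key : defect z = (shear z.2 - z.2) +
      Real.goldenRatio * ((shear z.2 - z.2) + (shear (Ht z).1 - (Ht z).1)) := by
    have hs := Real.goldenRatio_sq
    simp only [defect, ell, lam, Ht_snd, Ht_fst]
    linear_combination (-z.2) * hs
  rw [key, abs_of_nonneg (by nlinarith)]
  nlinarith

@[fun_prop]
lemma continuous_defect : Continuous defect := by unfold defect ell; fun_prop

/-- The functional on the plane which semiconjugates the lift to multiplication by `lam`;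
its level sets contain the stable leaves. -/
def Phi (z : ℝ × ℝ) : ℝ := ell z + ∑' n : ℕ, (lam⁻¹) ^ (n + 1) * defect (Ht^[n] z)

/-- A bound for `Phi - ell`. -/
def PhiBd : ℝ := ∑' n : ℕ, (lam⁻¹) ^ (n + 1) * (1 + 2 * Real.goldenRatio)

lemma summable_bound :
    Summable fun n : ℕ => (lam⁻¹) ^ (n + 1) * (1 + 2 * Real.goldenRatio) := by
  apply Summable.mul_right
  exact (summable_nat_add_iff 1).2
    (summable_geometric_of_lt_one (inv_nonneg.2 lam_pos.le) (inv_lt_one_of_one_lt₀ lam_gt_one))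

lemma norm_term_le (n : ℕ) (z : ℝ × ℝ) :
    ‖(lam⁻¹) ^ (n + 1) * defect (Ht^[n] z)‖ ≤
      (lam⁻¹) ^ (n + 1) * (1 + 2 * Real.goldenRatio) := by
  have := inv_nonneg.2 lam_pos.le
  rw [norm_mul, Real.norm_of_nonneg (by positivity)]
  exact mul_le_mul_of_nonneg_left (abs_defect_le _) (by positivity)

lemma summable_term (z : ℝ × ℝ) :
    Summable fun n : ℕ => (lam⁻¹) ^ (n + 1) * defect (Ht^[n] z) :=
  Summable.of_norm_bounded summable_bound fun n => norm_term_le n z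

lemma abs_Phi_sub_ell_le (z : ℝ × ℝ) : |Phi z - ell z| ≤ PhiBd := by
  have : Phi z - ell z = ∑' n : ℕ, (lam⁻¹) ^ (n + 1) * defect (Ht^[n] z) := by
    unfold Phi; ring
  rw [this]
  exact tsum_of_norm_bounded summable_bound.hasSum fun n => norm_term_le n z

@[fun_prop]
lemma continuous_Phi : Continuous Phi := by
  unfold Phi
  refine Continuous.add (by unfold ell; fun_prop) ?_
  exact continuous_tsum
    (fun n => continuous_const.mul (continuous_defect.comp (continuous_Ht.iterate n)))
    summable_bound norm_term_le

lemma Phi_Ht (z : ℝ × ℝ) : Phi (Ht z) = lam * Phi z := by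
  unfold Phi
  rw [(summable_term z).tsum_eq_zero_add, mul_add, mul_add, ← tsum_mul_left]
  have h : ∀ n : ℕ, lam * ((lam⁻¹) ^ (n + 1 + 1) * defect (Ht^[n + 1] z)) =
      (lam⁻¹) ^ (n + 1) * defect (Ht^[n] (Ht z)) := fun n => by
    rw [Function.iterate_succ_apply, pow_succ (lam⁻¹) (n + 1)]
    field_simp [lam_pos.ne']
  simp_rw [h]
  have h0 : lam * ((lam⁻¹) ^ (0 + 1) * defect (Ht^[0] z)) = defect z := by
    have := lam_pos.ne'
    simp [this]
  rw [h0, defect]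
  ring

lemma Phi_iterate (n : ℕ) (z : ℝ × ℝ) : Phi (Ht^[n] z) = lam ^ n * Phi z := by
  induction n with
  | zero => simp
  | succ n ih => rw [Function.iterate_succ_apply', Phi_Ht, ih, pow_succ]; ring

lemma Phi_iterate_eq {z w : ℝ × ℝ} (h : Phi z = Phi w) (n : ℕ) :
    Phi (Ht^[n] z) = Phi (Ht^[n] w) := by
  rw [Phi_iterate, Phi_iterate, h]

lemma ell_mono : Monotone ell := fun z w h => by
  have := mul_le_mul_of_nonneg_left h.2 Real.goldenRatio_pos.le
  unfold ell; linarith [h.1]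

lemma Phi_mono : Monotone Phi := fun z w h => by
  by_contra hc
  rw [not_le] at hc
  have key : ∀ n : ℕ, lam ^ n * (Phi z - Phi w) ≤ 2 * PhiBd := fun n => by
    have h1 := ell_mono (Ht_mono.iterate n h)
    have h2 := abs_le.1 (abs_Phi_sub_ell_le (Ht^[n] z))
    have h3 := abs_le.1 (abs_Phi_sub_ell_le (Ht^[n] w))
    rw [mul_sub, ← Phi_iterate, ← Phi_iterate]
    linarith [h2.2, h3.1]
  obtain ⟨n, hn⟩ := pow_unbounded_of_one_lt (2 * PhiBd / (Phi z - Phi w)) lam_gt_one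
  rw [div_lt_iff₀ (sub_pos.2 hc)] at hn
  linarith [key n]

lemma le_zero_of_frequently_le_abs_sub {f : ℕ → ℝ} {l c : ℝ} (hf : Tendsto f atTop (𝓝 l))
    (h : ∃ᶠ n in atTop, c ≤ |f (n + 1) - f n|) : c ≤ 0 := by
  have h1 : Tendsto (fun n => |f (n + 1) - f n|) atTop (𝓝 0) := by
    simpa using (((tendsto_add_atTop_iff_nat 1).2 hf).sub hf).abs
  exact ge_of_tendsto_of_frequently h1 h

/-- The orbit of `z` returns infinitely often to the core, at distance at least `ε` from its
boundary. -/
def Rec (ε : ℝ) (z : ℝ × ℝ) : Prop :=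
  ∃ᶠ n in atTop, Act ε (Ht^[n] z).1 ∧ Act ε (Ht^[n] z).2

lemma frequently_atTop_succ {p : ℕ → Prop} (h : ∃ᶠ n in atTop, p n) :
    ∃ᶠ n in atTop, p (n + 1) := by
  rw [← map_add_atTop_eq_nat 1, frequently_map] at h
  exact h

lemma Rec.map {ε : ℝ} {z : ℝ × ℝ} (h : Rec ε z) : Rec ε (Ht z) := by
  simpa only [Rec, Function.iterate_succ_apply] using frequently_atTop_succ h

lemma Rec.frequently_snd {ε : ℝ} {p q : ℝ × ℝ} (h : Rec ε p ∨ Rec ε q) :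
    ∃ᶠ n in atTop, Act ε (Ht^[n] p).2 ∨ Act ε (Ht^[n] q).2 := by
  rcases h with h | h
  · exact h.mono fun n hn => Or.inl hn.2
  · exact h.mono fun n hn => Or.inr hn.2

lemma Rec.frequently_fst {ε : ℝ} {p q : ℝ × ℝ} (h : Rec ε p ∨ Rec ε q) :
    ∃ᶠ n in atTop, Act ε (Ht^[n + 1] p).1 ∨ Act ε (Ht^[n + 1] q).1 := by
  rcases h with h | h
  · exact (frequently_atTop_succ h).mono fun n hn => Or.inl hn.1
  · exact (frequently_atTop_succ h).mono fun n hn => Or.inr hn.1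

lemma tendsto_of_monotone_of_le {f : ℕ → ℝ} (hf : Monotone f) {C : ℝ} (h : ∀ n, f n ≤ C) :
    ∃ l, Tendsto f atTop (𝓝 l) :=
  ⟨_, tendsto_atTop_ciSup hf ⟨C, by rintro _ ⟨n, rfl⟩; exact h n⟩⟩

/-- Distinct points on a common level of `Phi` are never comparable. -/
lemma eq_of_le_of_Phi_eq {ε : ℝ} (hε : 0 < ε) {p q : ℝ × ℝ} (hr : Rec ε p ∨ Rec ε q)
    (hle : p ≤ q) (hP : Phi p = Phi q) : p = q := by
  have hn : ∀ n, Ht^[n] p ≤ Ht^[n] q := fun n => Ht_mono.iterate n hle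
  have ha : Monotone fun n => (Ht^[n] q).1 - (Ht^[n] p).1 := monotone_nat_of_le_succ fun n => by
    rw [iterate_Ht_fst, iterate_Ht_fst]; linarith [shear_mono (hn n).2]
  have hb : Monotone fun n => (Ht^[n] q).2 - (Ht^[n] p).2 := monotone_nat_of_le_succ fun n => by
    rw [iterate_Ht_snd, iterate_Ht_snd]; linarith [shear_mono (hn (n + 1)).1]
  have hg := Real.goldenRatio_pos
  have hell : ∀ n, ((Ht^[n] q).1 - (Ht^[n] p).1) +
      Real.goldenRatio * ((Ht^[n] q).2 - (Ht^[n] p).2) ≤ 2 * PhiBd := fun n => by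
    have h1 := abs_le.1 (abs_Phi_sub_ell_le (Ht^[n] p))
    have h2 := abs_le.1 (abs_Phi_sub_ell_le (Ht^[n] q))
    have h3 := Phi_iterate_eq hP n
    simp only [ell] at h1 h2
    linarith [h1.2, h2.1]
  have hg1 := Real.one_lt_goldenRatio
  obtain ⟨la, hla⟩ := tendsto_of_monotone_of_le ha (C := 2 * PhiBd) fun n => by
    have := sub_nonneg.2 (hn n).2
    have := hell n
    nlinarith
  obtain ⟨lb, hlb⟩ := tendsto_of_monotone_of_le hb (C := 2 * PhiBd) fun n => by
    have := sub_nonneg.2 (hn n).2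
    have := sub_nonneg.2 (hn n).1
    have := hell n
    nlinarith
  have hb0 : 2 * min (q.2 - p.2) ε ≤ 0 := by
    refine le_zero_of_frequently_le_abs_sub hla ((Rec.frequently_snd hr).mono fun n hact => ?_)
    have h1 := two_mul_min_le_shear_sub (hn n).2 hact
    have h2 : q.2 - p.2 ≤ _ := hb (Nat.zero_le n)
    refine le_trans ?_ (le_abs_self _)
    rw [iterate_Ht_fst, iterate_Ht_fst]
    have := min_le_min_right ε h2
    linarith
  have ha0 : 2 * min (q.1 - p.1) ε ≤ 0 := by
    refine le_zero_of_frequently_le_abs_sub hlb ((Rec.frequently_fst hr).mono fun n hact => ?_)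
    have h1 := two_mul_min_le_shear_sub (hn (n + 1)).1 hact
    have h2 : q.1 - p.1 ≤ _ := ha (Nat.zero_le (n + 1))
    refine le_trans ?_ (le_abs_self _)
    rw [iterate_Ht_snd, iterate_Ht_snd]
    have := min_le_min_right ε h2
    linarith
  have hb1 : q.2 - p.2 ≤ 0 := by
    rcases min_le_iff.1 (by linarith : min (q.2 - p.2) ε ≤ 0) with h | h <;> linarith
  have ha1 : q.1 - p.1 ≤ 0 := by
    rcases min_le_iff.1 (by linarith : min (q.1 - p.1) ε ≤ 0) with h | h <;> linarith
  exact Prod.ext (le_antisymm hle.1 (by linarith)) (le_antisymm hle.2 (by linarith))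

/-- `v` lies to the lower right of `u` on a common level of `Phi`, at least one of the two points
being recurrent. -/
structure Leaf (ε : ℝ) (u v : ℝ × ℝ) : Prop where
  rec_or : Rec ε u ∨ Rec ε v
  Phi_eq : Phi u = Phi v
  fst_le : u.1 ≤ v.1
  snd_le : v.2 ≤ u.2

lemma leaf_or_leaf {ε : ℝ} (hε : 0 < ε) {u v : ℝ × ℝ} (hr : Rec ε u ∨ Rec ε v)
    (hP : Phi u = Phi v) : Leaf ε u v ∨ Leaf ε v u := by
  rcases le_total u.1 v.1 with h1 | h1 <;> rcases le_total u.2 v.2 with h2 | h2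
  · have := eq_of_le_of_Phi_eq hε hr ⟨h1, h2⟩ hP
    subst this
    exact Or.inl ⟨hr, rfl, le_rfl, le_rfl⟩
  · exact Or.inl ⟨hr, hP, h1, h2⟩
  · exact Or.inr ⟨hr.symm, hP.symm, h1, h2⟩
  · have := eq_of_le_of_Phi_eq hε hr.symm ⟨h1, h2⟩ hP.symm
    subst this
    exact Or.inl ⟨hr, rfl, le_rfl, le_rfl⟩

lemma Leaf.map {ε : ℝ} (hε : 0 < ε) {u v : ℝ × ℝ} (h : Leaf ε u v) : Leaf ε (Ht u) (Ht v) := by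
  have hr : Rec ε (Ht u) ∨ Rec ε (Ht v) := h.rec_or.imp Rec.map Rec.map
  have hP : Phi (Ht u) = Phi (Ht v) := by rw [Phi_Ht, Phi_Ht, h.Phi_eq]
  rcases leaf_or_leaf hε hr hP with h' | h'
  · exact h'
  · have h1 := shear_mono h'.fst_le
    have h2 := h'.snd_le
    rw [Ht_snd, Ht_snd v] at h2
    have := eq_of_le_of_Phi_eq hε h.rec_or ⟨h.fst_le, by linarith⟩ h.Phi_eq
    subst this
    exact h'

lemma Leaf.iterate {ε : ℝ} (hε : 0 < ε) {u v : ℝ × ℝ} (h : Leaf ε u v) (n : ℕ) :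
    Leaf ε (Ht^[n] u) (Ht^[n] v) := by
  induction n with
  | zero => exact h
  | succ n ih => rw [Function.iterate_succ_apply', Function.iterate_succ_apply']; exact ih.map hε

lemma Leaf.antitone_fst {ε : ℝ} (hε : 0 < ε) {u v : ℝ × ℝ} (h : Leaf ε u v) :
    Antitone fun n => (Ht^[n] v).1 - (Ht^[n] u).1 := antitone_nat_of_succ_le fun n => by
  rw [iterate_Ht_fst, iterate_Ht_fst]
  linarith [shear_mono (h.iterate hε n).snd_le]

lemma Leaf.antitone_snd {ε : ℝ} (hε : 0 < ε) {u v : ℝ × ℝ} (h : Leaf ε u v) :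
    Antitone fun n => (Ht^[n] u).2 - (Ht^[n] v).2 := antitone_nat_of_succ_le fun n => by
  rw [iterate_Ht_snd, iterate_Ht_snd]
  linarith [shear_mono (h.iterate hε (n + 1)).fst_le]

lemma tendsto_of_antitone_of_nonneg {f : ℕ → ℝ} (hf : Antitone f) (h : ∀ n, 0 ≤ f n) :
    ∃ l, Tendsto f atTop (𝓝 l) :=
  ⟨_, tendsto_atTop_ciInf hf ⟨0, by rintro _ ⟨n, rfl⟩; exact h n⟩⟩

/-- Points on a common level of `Phi` are forward asymptotic. -/
lemma Leaf.tendsto {ε : ℝ} (hε : 0 < ε) {u v : ℝ × ℝ} (h : Leaf ε u v) :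
    Tendsto (fun n => Ht^[n] v - Ht^[n] u) atTop (𝓝 0) := by
  have hA := h.antitone_fst hε
  have hB := h.antitone_snd hε
  have hA0 : ∀ n, 0 ≤ (Ht^[n] v).1 - (Ht^[n] u).1 := fun n =>
    sub_nonneg.2 (h.iterate hε n).fst_le
  have hB0 : ∀ n, 0 ≤ (Ht^[n] u).2 - (Ht^[n] v).2 := fun n =>
    sub_nonneg.2 (h.iterate hε n).snd_le
  obtain ⟨a, ha⟩ := tendsto_of_antitone_of_nonneg hA hA0
  obtain ⟨b, hb⟩ := tendsto_of_antitone_of_nonneg hB hB0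
  have ha0 : 0 ≤ a := ge_of_tendsto' ha hA0
  have hb0 : 0 ≤ b := ge_of_tendsto' hb hB0
  have hb1 : 2 * min b ε ≤ 0 := by
    refine le_zero_of_frequently_le_abs_sub ha
      ((Rec.frequently_snd h.rec_or).mono fun n hact => ?_)
    have h1 := two_mul_min_le_shear_sub (h.iterate hε n).snd_le hact.symm
    have h2 : b ≤ _ := hB.le_of_tendsto hb n
    refine le_trans ?_ (neg_le_abs _)
    rw [iterate_Ht_fst, iterate_Ht_fst]
    have := min_le_min_right ε h2
    linarith
  have ha1 : 2 * min a ε ≤ 0 := by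
    refine le_zero_of_frequently_le_abs_sub hb
      ((Rec.frequently_fst h.rec_or).mono fun n hact => ?_)
    have h1 := two_mul_min_le_shear_sub (h.iterate hε (n + 1)).fst_le hact
    have h2 : a ≤ _ := hA.le_of_tendsto ha (n + 1)
    refine le_trans ?_ (neg_le_abs _)
    rw [iterate_Ht_snd, iterate_Ht_snd]
    have := min_le_min_right ε h2
    linarith
  have hb2 : b = 0 := by
    rcases min_le_iff.1 (by linarith : min b ε ≤ 0) with h | h <;> linarith
  have ha2 : a = 0 := by
    rcases min_le_iff.1 (by linarith : min a ε ≤ 0) with h | h <;> linarith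
  subst ha2 hb2
  have := ha.prodMk_nhds (by simpa using hb.neg :
    Tendsto (fun n => (Ht^[n] v).2 - (Ht^[n] u).2) atTop (𝓝 0))
  exact this

lemma tendsto_sub_of_Phi_eq {ε : ℝ} (hε : 0 < ε) {u v : ℝ × ℝ} (hr : Rec ε u ∨ Rec ε v)
    (hP : Phi u = Phi v) : Tendsto (fun n => Ht^[n] v - Ht^[n] u) atTop (𝓝 0) := by
  rcases leaf_or_leaf hε hr hP with h | h
  · exact h.tendsto hε
  · simpa using (h.tendsto hε).neg

/-- The orbit of `z` stays away from the singular lines, in terms of the number of visits to the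
core. -/
def Kp (δ : ℝ) (z : ℝ × ℝ) : Prop :=
  ∃ c : ℕ → ℕ, c 0 = 0 ∧ Even ⌊z.2⌋ ∧
    (∀ n, c (n + 1) = c n ∨
      (c (n + 1) = c n + 1 ∧ Even ⌊(Ht^[n + 1] z).1⌋ ∧ Even ⌊(Ht^[n + 1] z).2⌋)) ∧
    ∀ n, δ / 4 ^ c n ≤ kap (Ht^[n] z).2 ∧ δ / 4 ^ c n ≤ kap (Ht^[n + 1] z).1

lemma min_add_eq {B D A : ℝ} (h : 2 * min B D ≤ A) (hA : A < D) (hA0 : 0 ≤ A) :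
    2 * B ≤ A := by
  rcases min_cases B D with ⟨h1, h2⟩ | ⟨h1, h2⟩ <;> rw [h1] at h <;> linarith

lemma Leaf.floor_eq {ε δ : ℝ} (hε : 0 < ε) {u v z : ℝ × ℝ} (h : Leaf ε u v) (hz : z = u ∨ z = v)
    (hK : Kp δ z) (hδ : v.1 - u.1 < δ) : 2 * (u.2 - v.2) ≤ v.1 - u.1 ∧
    ∀ n, ⌊(Ht^[n] u).2⌋ = ⌊(Ht^[n] v).2⌋ ∧ ⌊(Ht^[n + 1] u).1⌋ = ⌊(Ht^[n + 1] v).1⌋ := by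
  obtain ⟨c, hc0, hev, hc, hk⟩ := hK
  have hA := h.antitone_fst hε
  have hB := h.antitone_snd hε
  have hA0 : ∀ n, 0 ≤ (Ht^[n] v).1 - (Ht^[n] u).1 := fun n =>
    sub_nonneg.2 (h.iterate hε n).fst_le
  have hB0 : ∀ n, 0 ≤ (Ht^[n] u).2 - (Ht^[n] v).2 := fun n =>
    sub_nonneg.2 (h.iterate hε n).snd_le
  set a := v.1 - u.1 with ha
  have ha0 : 0 ≤ a := hA0 0
  have hfst : ∀ n, Even ⌊(Ht^[n] z).2⌋ → (Ht^[n] v).1 - (Ht^[n] u).1 < δ / 4 ^ c n →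
      2 * ((Ht^[n] u).2 - (Ht^[n] v).2) ≤ (Ht^[n] v).1 - (Ht^[n] u).1 := fun n he hlt => by
    have h1 := two_mul_min_le_shear_sub (ε := δ / 4 ^ c n) (h.iterate hε n).snd_le (by
      rcases hz with rfl | rfl
      · exact Or.inr ⟨he, (hk n).1⟩
      · exact Or.inl ⟨he, (hk n).1⟩)
    refine min_add_eq (h1.trans ?_) hlt (hA0 n)
    have := hA0 (n + 1)
    rw [iterate_Ht_fst, iterate_Ht_fst] at this
    linarith
  have hsnd : ∀ n, Even ⌊(Ht^[n + 1] z).1⌋ → (Ht^[n + 1] v).1 - (Ht^[n + 1] u).1 < δ / 4 ^ c n →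
      2 * ((Ht^[n + 1] v).1 - (Ht^[n + 1] u).1) ≤ (Ht^[n] u).2 - (Ht^[n] v).2 :=
      fun n he hlt => by
    have h1 := two_mul_min_le_shear_sub (ε := δ / 4 ^ c n) (h.iterate hε (n + 1)).fst_le (by
      rcases hz with rfl | rfl
      · exact Or.inl ⟨he, (hk n).2⟩
      · exact Or.inr ⟨he, (hk n).2⟩)
    rw [min_eq_left hlt.le] at h1
    have := hB0 (n + 1)
    rw [iterate_Ht_snd, iterate_Ht_snd] at this
    linarith
  have key : ∀ n, (Ht^[n + 1] v).1 - (Ht^[n + 1] u).1 ≤ a / 4 ^ c n ∧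
      (Ht^[n] u).2 - (Ht^[n] v).2 ≤ a / 4 ^ c n / 2 := by
    intro n
    induction n with
    | zero =>
      refine ⟨?_, ?_⟩
      · rw [hc0, pow_zero, div_one]; exact hA (Nat.zero_le 1)
      · have := hfst 0 (by rcases hz with rfl | rfl <;> exact hev) (by simpa [hc0] using hδ)
        rw [hc0]
        simp only [Function.iterate_zero, id] at this ⊢
        linarith
    | succ n ih =>
      have h1 := hA (Nat.le_succ (n + 1))
      have h2 := hB (Nat.le_succ n)
      simp only [Nat.succ_eq_add_one] at h1 h2
      rcases hc n with h | ⟨h, hx, hy⟩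
      · rw [h]
        exact ⟨h1.trans ih.1, h2.trans ih.2⟩
      · have hlt : a / 4 ^ c n < δ / 4 ^ c n := by gcongr
        have h3 := hsnd n hx (ih.1.trans_lt hlt)
        have h4 : (Ht^[n + 1] v).1 - (Ht^[n + 1] u).1 ≤ a / 4 ^ c (n + 1) := by
          rw [h, pow_succ, ← div_div]; linarith [ih.2]
        have hlt' : a / 4 ^ c (n + 1) < δ / 4 ^ c (n + 1) := by gcongr
        have h5 := hfst (n + 1) hy (h4.trans_lt hlt')
        exact ⟨h1.trans h4, by linarith⟩
  refine ⟨?_, fun n => ?_⟩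
  · have := (key 0).2
    simp only [hc0, pow_zero, div_one, Function.iterate_zero, id] at this
    linarith
  · have hlt : a / 4 ^ c n < δ / 4 ^ c n := by gcongr
    have h0 : 0 ≤ a / 4 ^ c n := by positivity
    have h1 : |(Ht^[n] u).2 - (Ht^[n] v).2| < kap (Ht^[n] z).2 := by
      rw [abs_of_nonneg (hB0 n)]
      exact (key n).2.trans_lt (by linarith [(hk n).1])
    have h2 : |(Ht^[n + 1] v).1 - (Ht^[n + 1] u).1| < kap (Ht^[n + 1] z).1 := by
      rw [abs_of_nonneg (hA0 _)]
      exact (key n).1.trans_lt (by linarith [(hk n).2])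
    rcases hz with rfl | rfl
    · exact ⟨(floor_eq_of_abs_lt_kap (by rwa [abs_sub_comm])).symm,
        (floor_eq_of_abs_lt_kap h2).symm⟩
    · exact ⟨floor_eq_of_abs_lt_kap h1, floor_eq_of_abs_lt_kap (by rwa [abs_sub_comm])⟩

/-- The derivative of the `n`-th iterate of the lift at `z`. -/
def Lin (z : ℝ × ℝ) : ℕ → ℝ × ℝ → ℝ × ℝ
  | 0, v => v
  | n + 1, v => ((Lin z n v).1 + slo (Ht^[n] z).2 * (Lin z n v).2,
      (Lin z n v).2 + slo (Ht^[n + 1] z).1 *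
        ((Lin z n v).1 + slo (Ht^[n] z).2 * (Lin z n v).2))

lemma Lin_sub_smul (z : ℝ × ℝ) (n : ℕ) (v w : ℝ × ℝ) (t : ℝ) :
    Lin z n (v - t • w) = Lin z n v - t • Lin z n w := by
  induction n with
  | zero => rfl
  | succ n ih =>
    simp only [Lin, ih]
    ext <;> simp <;> ring

lemma slo_nonneg (y : ℝ) : 0 ≤ slo y := by unfold slo; split_ifs <;> norm_num

lemma le_Lin (z : ℝ × ℝ) (n : ℕ) {v : ℝ × ℝ} (hv : 0 ≤ v) : v ≤ Lin z n v := by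
  induction n with
  | zero => exact le_rfl
  | succ n ih =>
    have h1 : 0 ≤ (Lin z n v).1 := hv.1.trans ih.1
    have h2 : 0 ≤ (Lin z n v).2 := hv.2.trans ih.2
    have h3 := mul_nonneg (slo_nonneg (Ht^[n] z).2) h2
    have h4 := mul_nonneg (slo_nonneg (Ht^[n + 1] z).1) (add_nonneg h1 h3)
    exact ⟨by simp only [Lin]; linarith [ih.1], by simp only [Lin]; linarith [ih.2]⟩

lemma iterate_sub_eq_Lin {z w : ℝ × ℝ}
    (h : ∀ n, ⌊(Ht^[n] w).2⌋ = ⌊(Ht^[n] z).2⌋ ∧ ⌊(Ht^[n + 1] w).1⌋ = ⌊(Ht^[n + 1] z).1⌋) (n : ℕ) :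
    Ht^[n] w - Ht^[n] z = Lin z n (w - z) := by
  induction n with
  | zero => rfl
  | succ n ih =>
    have h1 : (Ht^[n + 1] w).1 - (Ht^[n + 1] z).1 = (Lin z (n + 1) (w - z)).1 := by
      rw [iterate_Ht_fst, iterate_Ht_fst]
      simp only [Lin, ← ih, Prod.fst_sub, Prod.snd_sub]
      linarith [shear_sub_eq_slo_mul (h n).1]
    ext
    · exact h1
    · rw [Prod.snd_sub, iterate_Ht_snd, iterate_Ht_snd]
      have h2 := shear_sub_eq_slo_mul (h n).2
      rw [h1] at h2
      simp only [Lin, ← ih, Prod.fst_sub, Prod.snd_sub] at h2 ⊢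
      linarith

lemma eq_zero_of_tendsto_Lin {z : ℝ × ℝ} {d : ℝ}
    (h : Tendsto (fun n => Lin z n (0, d)) atTop (𝓝 0)) : d = 0 := by
  have key : ∀ d : ℝ, Tendsto (fun n => Lin z n (0, d)) atTop (𝓝 0) → 0 ≤ d → d = 0 :=
    fun d h hd => le_antisymm (ge_of_tendsto' h fun n => le_Lin z n ⟨le_rfl, hd⟩).2 hd
  rcases le_total 0 d with hd | hd
  · exact key d h hd
  · have := key (-d) (by
      have : ∀ n, Lin z n (0, -d) = - Lin z n (0, d) := fun n => by
        have h1 := Lin_sub_smul z n (0, d) (0, d) 2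
        have h2 : ((0, d) - (2 : ℝ) • (0, d) : ℝ × ℝ) = (0, -d) := by ext <;> simp; ring
        rw [h2] at h1
        rw [h1]; ext <;> simp <;> ring
      simp only [this]
      simpa using h.neg) (by linarith)
    linarith

lemma exists_Phi_eq (x a : ℝ) : ∃ y, Phi (x, y) = a := by
  have hc : Continuous fun y => Phi (x, y) := by fun_prop
  have hg := Real.goldenRatio_pos
  have hb : ∀ y, |Phi (x, y) - (x + Real.goldenRatio * y)| ≤ PhiBd := fun y =>
    abs_Phi_sub_ell_le (x, y)
  obtain ⟨y, -, hy⟩ := intermediate_value_uIcc (a := (a - PhiBd - x) / Real.goldenRatio)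
    (b := (a + PhiBd - x) / Real.goldenRatio) hc.continuousOn (show a ∈ _ by
      have h1 := abs_le.1 (hb ((a - PhiBd - x) / Real.goldenRatio))
      have h2 := abs_le.1 (hb ((a + PhiBd - x) / Real.goldenRatio))
      rw [mul_div_cancel₀ _ hg.ne'] at h1 h2
      exact Set.mem_uIcc.2 (Or.inl ⟨by linarith [h1.2], by linarith [h2.1]⟩))
  exact ⟨y, hy⟩

lemma tendsto_Lin_of_Phi_eq {ε δ : ℝ} (hε : 0 < ε) {z w : ℝ × ℝ} (hr : Rec ε z) (hK : Kp δ z)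
    (hw : |w.1 - z.1| < δ) (hP : Phi w = Phi z) :
    Tendsto (fun n => Lin z n (w - z)) atTop (𝓝 0) ∧
      0 ≤ (z.2 - w.2) * (w.1 - z.1) ∧ 2 * |z.2 - w.2| ≤ |w.1 - z.1| := by
  rw [abs_lt] at hw
  rcases leaf_or_leaf hε (Or.inl hr) hP.symm with h | h
  · have h1 := h.floor_eq hε (Or.inl rfl) hK hw.2
    have h2 := h.tendsto hε
    simp only [iterate_sub_eq_Lin fun n => ⟨(h1.2 n).1.symm, (h1.2 n).2.symm⟩] at h2
    have h3 := sub_nonneg.2 h.fst_le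
    have h4 := sub_nonneg.2 h.snd_le
    refine ⟨h2, mul_nonneg h4 h3, ?_⟩
    rw [abs_of_nonneg h3, abs_of_nonneg h4]
    exact h1.1
  · have h1 := h.floor_eq hε (Or.inr rfl) hK (by linarith)
    have h2 : Tendsto (fun n => Ht^[n] w - Ht^[n] z) atTop (𝓝 0) := by
      simpa using (h.tendsto hε).neg
    simp only [iterate_sub_eq_Lin h1.2] at h2
    have h3 := sub_nonneg.2 h.fst_le
    have h4 := sub_nonneg.2 h.snd_le
    refine ⟨h2, by nlinarith, ?_⟩
    rw [abs_sub_comm, abs_sub_comm w.1, abs_of_nonneg h3, abs_of_nonneg h4]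
    exact h1.1

/-- Near a point `z` whose orbit avoids the singularities, the level set of `Phi` through `z` is
a segment. -/
lemma exists_slope {ε δ : ℝ} (hε : 0 < ε) (hδ : 0 < δ) {z : ℝ × ℝ} (hr : Rec ε z)
    (hK : Kp δ z) : ∃ s : ℝ, 0 ≤ s ∧ s ≤ 1 / 2 ∧ ∀ t, |t| < δ → ∀ y,
      Phi (z.1 + t, y) = Phi z ↔ y = z.2 - s * t := by
  obtain ⟨y₀, hy₀⟩ := exists_Phi_eq (z.1 + δ / 2) (Phi z)
  obtain ⟨h1, h2, h3⟩ := tendsto_Lin_of_Phi_eq hε hr hK (w := (z.1 + δ / 2, y₀))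
    (by simp only [add_sub_cancel_left]; rw [abs_of_pos (by linarith)]; linarith) hy₀
  simp only [add_sub_cancel_left] at h2 h3
  have h4 : 0 ≤ z.2 - y₀ := by
    by_contra hc
    nlinarith
  rw [abs_of_nonneg h4, abs_of_pos (by linarith)] at h3
  have key : ∀ t, |t| < δ → ∀ y, Phi (z.1 + t, y) = Phi z →
      y = z.2 - (z.2 - y₀) / (δ / 2) * t := fun t ht y hy => by
    obtain ⟨h5, -, -⟩ := tendsto_Lin_of_Phi_eq hε hr hK (w := (z.1 + t, y))
      (by simpa using ht) hy
    have h6 := h5.sub (h1.const_smul (t / (δ / 2)))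
    simp only [← Lin_sub_smul, smul_zero, sub_zero] at h6
    have h7 : ((z.1 + t, y) - z - (t / (δ / 2)) • ((z.1 + δ / 2, y₀) - z) : ℝ × ℝ) =
        (0, y - z.2 + (z.2 - y₀) / (δ / 2) * t) := by
      ext
      · simp; field_simp; ring
      · simp; field_simp; ring
    rw [h7] at h6
    linarith [eq_zero_of_tendsto_Lin h6]
  refine ⟨(z.2 - y₀) / (δ / 2), by positivity, ?_, fun t ht y => ⟨key t ht y, ?_⟩⟩
  · rw [div_le_iff₀ (by linarith)]; linarith
  · rintro rfl
    obtain ⟨y, hy⟩ := exists_Phi_eq (z.1 + t) (Phi z)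
    rwa [← key t ht y hy]

/-- The set `A` has Lebesgue density one at `z`. -/
def Dens1 (A : Set (ℝ × ℝ)) (z : ℝ × ℝ) : Prop :=
  ∀ ε : ℝ, 0 < ε → ∃ r₀ : ℝ, 0 < r₀ ∧ ∀ r : ℝ, 0 < r → r < r₀ →
    volume (Metric.closedBall z r \ A) ≤ ENNReal.ofReal (ε * r ^ 2)

lemma volume_closedBall_prod (z : ℝ × ℝ) {r : ℝ} (hr : 0 ≤ r) :
    volume (Metric.closedBall z r) = ENNReal.ofReal (4 * r ^ 2) := by
  rw [← Prod.mk.eta (p := z), ← closedBall_prod_same, Measure.volume_eq_prod, Measure.prod_prod,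
    Real.volume_closedBall, Real.volume_closedBall, ← ENNReal.ofReal_mul (by positivity)]
  congr 1; ring

lemma Dens1.of_le {A E : Set (ℝ × ℝ)} {w z : ℝ × ℝ} {C L ρ : ℝ} (hC : 0 ≤ C) (hL : 0 < L)
    (hρ : 0 < ρ) (hE : Dens1 E z)
    (h : ∀ r, 0 < r → r < ρ → volume (Metric.closedBall w r \ A) ≤
      ENNReal.ofReal C * volume (Metric.closedBall z (L * r) \ E)) : Dens1 A w := by
  intro ε hε
  obtain ⟨r₀, hr₀, H0⟩ := hE (ε / (C * L ^ 2 + 1)) (by positivity)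
  refine ⟨min ρ (r₀ / L), by positivity, fun r hr hlt => (h r hr (lt_min_iff.1 hlt).1).trans ?_⟩
  have h1 : L * r < r₀ := by
    have := (lt_min_iff.1 hlt).2
    rwa [lt_div_iff₀ hL, mul_comm] at this
  refine (mul_le_mul_right (H0 _ (by positivity) h1) _).trans ?_
  rw [← ENNReal.ofReal_mul hC]
  apply ENNReal.ofReal_le_ofReal
  have h2 : C * (ε / (C * L ^ 2 + 1) * (L * r) ^ 2) = ε * r ^ 2 * (C * L ^ 2 / (C * L ^ 2 + 1)) := by
    field_simp
  rw [h2]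
  refine mul_le_of_le_one_right (by positivity) ?_
  rw [div_le_one (by positivity)]
  linarith

lemma Dens1.inter_ball {A : Set (ℝ × ℝ)} {z : ℝ × ℝ} (hA : Dens1 A z) {ρ : ℝ} (hρ : 0 < ρ) :
    Dens1 (A ∩ Metric.ball z ρ) z :=
  hA.of_le (C := 1) (L := 1) (ρ := ρ) zero_le_one one_pos hρ fun r _ hr => by
    rw [ENNReal.ofReal_one, one_mul, one_mul]
    refine measure_mono fun x hx => ⟨hx.1, fun hxA => hx.2 ⟨hxA, ?_⟩⟩
    exact Metric.closedBall_subset_ball hr hx.1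

lemma Dens1.false_of_disjoint {A B : Set (ℝ × ℝ)} {z : ℝ × ℝ} (hA : Dens1 A z) (hB : Dens1 B z)
    (h : Disjoint A B) : False := by
  obtain ⟨r₁, h1, H1⟩ := hA 1 one_pos
  obtain ⟨r₂, h2, H2⟩ := hB 1 one_pos
  obtain ⟨r, hr, hlt⟩ := exists_between (lt_min h1 h2)
  obtain ⟨hlt1, hlt2⟩ := lt_min_iff.1 hlt
  have hsub : Metric.closedBall z r ⊆
      (Metric.closedBall z r \ A) ∪ (Metric.closedBall z r \ B) := fun x hx => by
    by_cases hxA : x ∈ A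
    · exact Or.inr ⟨hx, Set.disjoint_left.1 h hxA⟩
    · exact Or.inl ⟨hx, hxA⟩
  have := (measure_mono hsub).trans ((measure_union_le _ _).trans
    (add_le_add (H1 r hr hlt1) (H2 r hr hlt2)))
  rw [volume_closedBall_prod z hr.le, ← ENNReal.ofReal_add (by positivity) (by positivity),
    ENNReal.ofReal_le_ofReal_iff (by positivity)] at this
  nlinarith

lemma ae_dens1 {E : Set (ℝ × ℝ)} (hE : MeasurableSet E) :
    ∀ᵐ z : ℝ × ℝ, z ∈ E → Dens1 E z := by
  filter_upwards [Besicovitch.ae_tendsto_measure_inter_div_of_measurableSet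
    (volume : Measure (ℝ × ℝ)) hE.compl] with z hz hzE ε hε
  rw [Set.indicator_of_notMem (by simpa using hzE)] at hz
  have h1 := hz.eventually (ge_mem_nhds (b := 0) (a := ENNReal.ofReal (ε / 4))
    (by rw [ENNReal.ofReal_pos]; linarith))
  obtain ⟨r₀, hr₀, h2⟩ := mem_nhdsGT_iff_exists_Ioo_subset.1 h1
  refine ⟨r₀, hr₀, fun r hr hlt => ?_⟩
  have h3 := h2 ⟨hr, hlt⟩
  simp only [Set.mem_ofPred_eq] at h3
  rw [volume_closedBall_prod z hr.le, ENNReal.div_le_iff (by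
    rw [ne_eq, ENNReal.ofReal_eq_zero, not_le]; positivity) ENNReal.ofReal_ne_top,
    ← ENNReal.ofReal_mul (by positivity), Set.inter_comm, ← Set.sdiff_eq] at h3
  convert h3 using 2
  ring

/-- Sliding points horizontally by `t` along segments of slope `-σ`. -/
def slide (t : ℝ) (σ : ℝ × ℝ → ℝ) (u : ℝ × ℝ) : ℝ × ℝ := (u.1 + t, u.2 - t * σ u)

lemma lipschitz_mul_sub {t : ℝ} {σ : ℝ × ℝ → ℝ} {K : ℝ≥0} (hσ : LipschitzWith K σ)
    (ht : |t| * K ≤ 1 / 2) (u v : ℝ × ℝ) : |t * σ u - t * σ v| ≤ dist u v / 2 := by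
  have h1 := hσ.dist_le_mul u v
  rw [Real.dist_eq] at h1
  rw [← mul_sub, abs_mul]
  calc |t| * |σ u - σ v| ≤ |t| * (K * dist u v) := by gcongr
    _ = |t| * K * dist u v := by ring
    _ ≤ 1 / 2 * dist u v := by gcongr
    _ = dist u v / 2 := by ring

lemma lipschitzWith_slide {t : ℝ} {σ : ℝ × ℝ → ℝ} {K : ℝ≥0} (hσ : LipschitzWith K σ)
    (ht : |t| * K ≤ 1 / 2) : LipschitzWith 2 (slide t σ) := by
  refine LipschitzWith.of_dist_le_mul fun u v => ?_
  have h0 := lipschitz_mul_sub hσ ht u v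
  have hd := dist_nonneg (x := u) (y := v)
  have h1 : |u.1 - v.1| ≤ dist u v := by rw [Prod.dist_eq]; exact le_max_left _ _
  have h2 : |u.2 - v.2| ≤ dist u v := by rw [Prod.dist_eq]; exact le_max_right _ _
  rw [Prod.dist_eq, Real.dist_eq, Real.dist_eq]
  rw [abs_le] at h0 h1 h2
  refine max_le ?_ ?_
  · rw [abs_le]; simp only [slide, NNReal.coe_ofNat]; constructor <;> linarith
  · rw [abs_le]; simp only [slide, NNReal.coe_ofNat]; constructor <;> linarith

lemma antilipschitzWith_slide {t : ℝ} {σ : ℝ × ℝ → ℝ} {K : ℝ≥0} (hσ : LipschitzWith K σ)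
    (ht : |t| * K ≤ 1 / 2) : AntilipschitzWith 2 (slide t σ) := by
  refine AntilipschitzWith.of_le_mul_dist fun u v => ?_
  have h0 := lipschitz_mul_sub hσ ht u v
  have hd := dist_nonneg (x := u) (y := v)
  have h1 : |(slide t σ u).1 - (slide t σ v).1| ≤ dist (slide t σ u) (slide t σ v) := by
    rw [Prod.dist_eq]; exact le_max_left _ _
  have h2 : |(slide t σ u).2 - (slide t σ v).2| ≤ dist (slide t σ u) (slide t σ v) := by
    rw [Prod.dist_eq]; exact le_max_right _ _
  set D := dist (slide t σ u) (slide t σ v)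
  have e1 : (slide t σ u).1 - (slide t σ v).1 = u.1 - v.1 := by simp [slide]
  have e2 : (slide t σ u).2 - (slide t σ v).2 = u.2 - v.2 - (t * σ u - t * σ v) := by
    simp [slide]; ring
  rw [e1] at h1
  rw [e2] at h2
  have h3 : |u.2 - v.2| ≤ D + dist u v / 2 := by
    have := abs_add_le (u.2 - v.2 - (t * σ u - t * σ v)) (t * σ u - t * σ v)
    rw [sub_add_cancel] at this
    linarith
  have h4 : dist u v = max |u.1 - v.1| |u.2 - v.2| := by
    rw [Prod.dist_eq, Real.dist_eq, Real.dist_eq]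
  have hD : 0 ≤ D := dist_nonneg
  simp only [NNReal.coe_ofNat]
  rcases max_cases |u.1 - v.1| |u.2 - v.2| with ⟨h, -⟩ | ⟨h, -⟩ <;> rw [h] at h4 <;> linarith

lemma slide_surjective {t : ℝ} {σ : ℝ × ℝ → ℝ} {K : ℝ≥0} (hσ : LipschitzWith K σ)
    (ht : |t| * K ≤ 1 / 2) : Function.Surjective (slide t σ) := by
  rintro ⟨x, y⟩
  have hcont : Continuous fun v => v - t * σ (x - t, v) := by
    have := hσ.continuous
    fun_prop
  have hlip : ∀ v, |t * σ (x - t, v) - t * σ (x - t, 0)| ≤ |v| / 2 := fun v => by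
    have := lipschitz_mul_sub hσ ht (x - t, v) (x - t, 0)
    have hd : dist ((x - t, v) : ℝ × ℝ) (x - t, 0) = |v| := by
      rw [Prod.dist_eq]; simp
    rwa [hd] at this
  set c := t * σ (x - t, 0)
  obtain ⟨v, hv⟩ := hcont.surjective
    (by
      refine tendsto_atTop_mono' _ (f₁ := fun v => v / 2 - c) ?_
        (tendsto_atTop_add_const_right _ _ (tendsto_id.atTop_div_const two_pos))
      filter_upwards [eventually_ge_atTop 0] with v hv
      have := abs_le.1 (hlip v)
      rw [abs_of_nonneg hv] at this
      linarith)
    (by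
      refine tendsto_atBot_mono' _ (f₁ := fun v => v / 2 - c) ?_
        (tendsto_atBot_add_const_right _ _ (tendsto_id.atBot_div_const two_pos))
      filter_upwards [eventually_le_atBot 0] with v hv
      have := abs_le.1 (hlip v)
      rw [abs_of_nonpos hv] at this
      linarith) y
  exact ⟨(x - t, v), by simp [slide, hv]⟩

lemma volume_image_le {f : ℝ × ℝ → ℝ × ℝ} (hf : LipschitzWith 2 f) (s : Set (ℝ × ℝ)) :
    volume (f '' s) ≤ 4 * volume s := by
  have := hf.hausdorffMeasure_image_le (d := 2) (by norm_num) s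
  rw [hausdorffMeasure_prod_real] at this
  refine this.trans_eq ?_
  congr 1
  norm_num [← ENNReal.rpow_natCast]

lemma volume_preimage_le {f : ℝ × ℝ → ℝ × ℝ} (hf : AntilipschitzWith 2 f) (s : Set (ℝ × ℝ)) :
    volume (f ⁻¹' s) ≤ 4 * volume s := by
  have := hf.hausdorffMeasure_preimage_le (d := 2) (by norm_num) s
  rw [hausdorffMeasure_prod_real] at this
  refine this.trans_eq ?_
  congr 1
  norm_num [← ENNReal.rpow_natCast]

/-- The level set of `Phi` through `z` is a segment of slope `-s` over the horizontal
`δ`-neighbourhood of `z`. -/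
def Slope (δ : ℝ) (z : ℝ × ℝ) (s : ℝ) : Prop :=
  0 ≤ s ∧ s ≤ 1 / 2 ∧ ∀ t, |t| < δ → ∀ y, Phi (z.1 + t, y) = Phi z ↔ y = z.2 - s * t

lemma Slope.Phi_slide {δ : ℝ} {z : ℝ × ℝ} {σ : ℝ × ℝ → ℝ} (h : Slope δ z (σ z)) {t : ℝ}
    (ht : |t| < δ) : Phi (slide t σ z) = Phi z :=
  (h.2.2 t ht _).2 (by rw [mul_comm])

/-- Segments of level sets do not cross, so their slope is a Lipschitz function. -/
lemma Slope.abs_sub_le {δ : ℝ} (hδ : 0 < δ) {z w : ℝ × ℝ} {s s' : ℝ} (hz : Slope δ z s)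
    (hw : Slope δ w s') (hd : |z.1 - w.1| < δ / 2) : |s - s'| ≤ 3 / δ * dist z w := by
  by_contra! hc
  have hdist := dist_nonneg (x := z) (y := w)
  have h1 : |z.1 - w.1| ≤ dist z w := by rw [Prod.dist_eq]; exact le_max_left _ _
  have h2 : |z.2 - w.2| ≤ dist z w := by rw [Prod.dist_eq]; exact le_max_right _ _
  set t := (z.2 - w.2 + s' * (z.1 - w.1)) / (s - s') with ht
  have hne : s - s' ≠ 0 := fun h => by
    rw [h, abs_zero] at hc
    have : 0 ≤ 3 / δ * dist z w := by positivity
    linarith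
  have habs : |z.2 - w.2 + s' * (z.1 - w.1)| ≤ 3 / 2 * dist z w := by
    refine (abs_add_le _ _).trans ?_
    rw [abs_mul, abs_of_nonneg hw.1]
    have := mul_le_mul hw.2.1 h1 (abs_nonneg _) (by norm_num)
    linarith
  have hpos : 0 < |s - s'| := abs_pos.2 hne
  have hts : |t| < δ / 2 := by
    rw [ht, abs_div, div_lt_iff₀ hpos]
    have h3 : δ / 2 * (3 / δ * dist z w) = 3 / 2 * dist z w := by field_simp
    have h4 : δ / 2 * (3 / δ * dist z w) < δ / 2 * |s - s'| := by gcongr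
    linarith
  have hcross : z.2 - s * t = w.2 - s' * (z.1 + t - w.1) := by
    rw [ht]; field_simp; ring
  have hP : Phi z = Phi w := by
    have e1 := (hz.2.2 t (by linarith) _).2 rfl
    have e2 := (hw.2.2 (z.1 + t - w.1) (by
      rw [abs_lt] at hts hd ⊢; constructor <;> linarith) _).2 rfl
    rw [← e1, ← e2, hcross, add_sub_cancel]
  have hall : ∀ r, |r| < δ / 2 → z.2 - s * r = w.2 - s' * (z.1 + r - w.1) := fun r hr => by
    have e1 := (hz.2.2 r (by linarith) _).2 rfl
    refine (hw.2.2 (z.1 + r - w.1) (by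
      rw [abs_lt] at hr hd ⊢; constructor <;> linarith) _).1 ?_
    rw [add_sub_cancel, e1, hP]
  have a1 := hall 0 (by simpa using hδ)
  have a2 := hall (δ / 4) (by rw [abs_of_pos] <;> linarith)
  exact hne (by nlinarith)

/-- If two families of points of the torus have asymptotic orbits, then almost surely both or none
lie in a given invariant set. -/
lemma volume_inter_preimage_diff_eq_zero {T : 𝕋 → 𝕋} (hT : MeasurePreserving T volume volume)
    {A : Set 𝕋} (hA : MeasurableSet A) (hinv : T ⁻¹' A = A) {E : Set (ℝ × ℝ)}
    {f g : ℝ × ℝ → 𝕋} {C : ℝ≥0}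
    (hf : ∀ W, MeasurableSet W → volume (E ∩ f ⁻¹' W) ≤ C * volume W)
    (hg : ∀ W, MeasurableSet W → volume (E ∩ g ⁻¹' W) ≤ C * volume W)
    (hd : ∀ u ∈ E, Tendsto (fun n => dist (T^[n] (f u)) (T^[n] (g u))) atTop (𝓝 0)) :
    volume ((E ∩ f ⁻¹' A) \ g ⁻¹' A) = 0 := by
  have hinvn : ∀ n, (T^[n]) ⁻¹' A = A := fun n => by
    induction n with
    | zero => rfl
    | succ n ih => rw [Function.iterate_succ, Set.preimage_comp, ih, hinv]
  have key : ∀ η : ℝ≥0∞, η ≠ 0 → volume ((E ∩ f ⁻¹' A) \ g ⁻¹' A) ≤ C * η + C * η := by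
    intro η hη
    obtain ⟨C1, hC1, hC1c, hC1m⟩ := hA.exists_isClosed_sdiff_lt (measure_ne_top volume A) hη
    obtain ⟨C2, hC2, hC2c, hC2m⟩ :=
      hA.compl.exists_isClosed_sdiff_lt (measure_ne_top volume Aᶜ) hη
    obtain ⟨d, hd0, hdisj⟩ := (Set.disjoint_left.2 fun x h1 h2 => hC2 h2 (hC1 h1) :
      Disjoint C1 C2).exists_thickenings hC1c.isCompact hC2c
    set B : ℕ → Set (ℝ × ℝ) := fun m => {u | u ∈ (E ∩ f ⁻¹' A) \ g ⁻¹' A ∧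
      ∀ n ≥ m, dist (T^[n] (f u)) (T^[n] (g u)) < d}
    have hBmono : Monotone B := fun m m' h u hu => ⟨hu.1, fun n hn => hu.2 n (h.trans hn)⟩
    have hU : (E ∩ f ⁻¹' A) \ g ⁻¹' A ⊆ ⋃ m, B m := fun u hu => by
      obtain ⟨m, hm⟩ := eventually_atTop.1 ((hd u hu.1.1).eventually (gt_mem_nhds hd0))
      exact Set.mem_iUnion.2 ⟨m, hu, hm⟩
    refine (measure_mono hU).trans ?_
    rw [hBmono.measure_iUnion]
    refine iSup_le fun m => ?_
    have hsub : B m ⊆ (E ∩ f ⁻¹' (T^[m] ⁻¹' (A \ C1))) ∪ (E ∩ g ⁻¹' (T^[m] ⁻¹' (Aᶜ \ C2))) := by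
      rintro u ⟨⟨⟨huE, hfA⟩, hgA⟩, hm⟩
      have h1 : T^[m] (f u) ∈ A := by
        rw [← Set.mem_preimage, hinvn]; exact hfA
      have h2 : T^[m] (g u) ∉ A := by
        rw [← Set.mem_preimage, hinvn]; exact hgA
      by_cases h3 : T^[m] (f u) ∈ C1
      · refine Or.inr ⟨huE, h2, fun h4 => ?_⟩
        refine Set.disjoint_left.1 hdisj ?_ (Metric.self_subset_thickening hd0 _ h4)
        refine Metric.mem_thickening_iff.2 ⟨T^[m] (f u), h3, ?_⟩
        rw [dist_comm]
        exact hm m le_rfl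
      · exact Or.inl ⟨huE, h1, h3⟩
    have hm1 : MeasurableSet (A \ C1) := hA.diff hC1c.measurableSet
    have hm2 : MeasurableSet (Aᶜ \ C2) := hA.compl.diff hC2c.measurableSet
    have hTm := hT.iterate m
    refine (measure_mono hsub).trans ((measure_union_le _ _).trans (add_le_add ?_ ?_))
    · refine (hf _ (hTm.measurable hm1)).trans ?_
      rw [hTm.measure_preimage hm1.nullMeasurableSet]
      gcongr
    · refine (hg _ (hTm.measurable hm2)).trans ?_
      rw [hTm.measure_preimage hm2.nullMeasurableSet]
      gcongr
  refine le_antisymm (ENNReal.le_of_forall_pos_le_add fun ε hε _ => ?_) zero_le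
  have := key ((ε / (2 * C + 1) : ℝ≥0) : ℝ≥0∞) (by
    rw [ne_eq, ENNReal.coe_eq_zero]; positivity)
  refine this.trans ?_
  rw [zero_add]
  norm_cast
  rw [← mul_add, ← two_mul, ← NNReal.coe_le_coe]
  push_cast
  have h : (C : ℝ) * (2 * (ε / (2 * C + 1))) = ε * (2 * C / (2 * C + 1)) := by ring
  rw [h]
  refine mul_le_of_le_one_right ε.2 ?_
  rw [div_le_one (by positivity)]
  linarith

/-- The projection from the plane to the torus. -/
def pr (z : ℝ × ℝ) : 𝕋 := ((z.1 : AddCircle (2:ℝ)), (z.2 : AddCircle (2:ℝ)))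

@[fun_prop]
lemma continuous_coe_circle : Continuous fun x : ℝ => (x : AddCircle (2:ℝ)) :=
  AddCircle.continuous_mk' 2

@[fun_prop]
lemma continuous_pr : Continuous pr := by
  unfold pr
  exact (continuous_coe_circle.comp continuous_fst).prodMk
    (continuous_coe_circle.comp continuous_snd)

lemma coe_two_mul_int (m : ℤ) : ((2 * m : ℝ) : AddCircle (2:ℝ)) = 0 := by
  rw [AddCircle.coe_eq_zero_iff]
  exact ⟨m, by rw [zsmul_eq_mul, mul_comm]⟩

lemma θ_coe (y : ℝ) : θ (y : AddCircle (2:ℝ)) = y - 2 * ⌊y / 2⌋ := by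
  rw [θ, AddCircle.coe_equivIco_mk_apply, Int.fract]
  ring

lemma θ_mem (x : AddCircle (2:ℝ)) : 0 ≤ θ x ∧ θ x < 2 := by
  have := ((AddCircle.equivIco (2:ℝ) 0) x).2
  exact ⟨this.1, this.2.trans_eq (zero_add _)⟩

lemma coe_θ (x : AddCircle (2:ℝ)) : ((θ x : ℝ) : AddCircle (2:ℝ)) = x :=
  (AddCircle.equivIco (2:ℝ) 0).symm_apply_apply x

lemma floor_eq_of_θ_lt {y : ℝ} (h : θ (y : AddCircle (2:ℝ)) < 1) : ⌊y⌋ = 2 * ⌊y / 2⌋ := by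
  have h0 := (θ_mem (y : AddCircle (2:ℝ))).1
  rw [θ_coe] at h h0
  rw [Int.floor_eq_iff]
  push_cast
  constructor <;> linarith

lemma floor_eq_of_le_θ {y : ℝ} (h : 1 ≤ θ (y : AddCircle (2:ℝ))) : ⌊y⌋ = 2 * ⌊y / 2⌋ + 1 := by
  have h0 := (θ_mem (y : AddCircle (2:ℝ))).2
  rw [θ_coe] at h h0
  rw [Int.floor_eq_iff]
  push_cast
  constructor <;> linarith

lemma even_floor_iff (y : ℝ) : Even ⌊y⌋ ↔ θ (y : AddCircle (2:ℝ)) < 1 := by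
  rcases lt_or_ge (θ (y : AddCircle (2:ℝ))) 1 with h | h
  · simp [h, floor_eq_of_θ_lt h]
  · simp [h.not_gt, floor_eq_of_le_θ h]

lemma kap_θ (y : ℝ) : kap (θ (y : AddCircle (2:ℝ))) = kap y := by
  have : Int.fract (θ (y : AddCircle (2:ℝ))) = Int.fract y := by
    rw [θ_coe, show (2 * (⌊y / 2⌋ : ℝ)) = ((2 * ⌊y / 2⌋ : ℤ) : ℝ) by push_cast; ring,
      Int.fract_sub_intCast]
  simp [kap, this]

/-- The twist profile on the circle. -/
def twist (x : AddCircle (2:ℝ)) : AddCircle (2:ℝ) :=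
  if θ x ≤ 1 then ((2 * θ x : ℝ) : AddCircle (2:ℝ)) else 0

lemma twist_coe (y : ℝ) : twist (y : AddCircle (2:ℝ)) = ((shear y : ℝ) : AddCircle (2:ℝ)) := by
  unfold twist
  rcases lt_or_ge (θ (y : AddCircle (2:ℝ))) 1 with h | h
  · have hs : shear y = 2 * θ (y : AddCircle (2:ℝ)) + 2 * (⌊y / 2⌋ : ℤ) := by
      rw [shear_of_even (floor_eq_of_θ_lt h) (by simp), θ_coe]; push_cast; ring
    rw [if_pos h.le, hs, AddCircle.coe_add, coe_two_mul_int, add_zero]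
  · have hs : shear y = 2 * ((⌊y / 2⌋ + 1 : ℤ) : ℝ) := by
      rw [shear_of_odd (floor_eq_of_le_θ h) (by simp)]; push_cast; ring
    rw [hs, coe_two_mul_int]
    split_ifs with h'
    · rw [le_antisymm h' h]
      simpa only [Int.cast_one] using coe_two_mul_int 1
    · rfl

lemma G_eq (z : 𝕋) : G z = (z.1, z.2 + twist z.1) := by
  unfold G twist
  split_ifs <;> simp

lemma F_eq (z : 𝕋) : F z = (z.1 + twist z.2, z.2) := by
  unfold F twist
  split_ifs <;> simp

lemma H_eq (z : 𝕋) : H z = (z.1 + twist z.2, z.2 + twist (z.1 + twist z.2)) := by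
  rw [H, Function.comp_apply, F_eq, G_eq]

lemma H_pr (z : ℝ × ℝ) : H (pr z) = pr (Ht z) := by
  simp only [H_eq, pr, Ht, AddCircle.coe_add, ← twist_coe]

lemma iterate_H_pr (n : ℕ) (z : ℝ × ℝ) : H^[n] (pr z) = pr (Ht^[n] z) := by
  induction n with
  | zero => rfl
  | succ n ih => rw [Function.iterate_succ_apply', Function.iterate_succ_apply', ih, H_pr]

@[fun_prop]
lemma measurable_θ : Measurable θ :=
  measurable_subtype_coe.comp (AddCircle.measurableEquivIco 2 0).measurable

@[fun_prop]
lemma measurable_twist : Measurable twist := by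
  unfold twist
  refine Measurable.ite (measurableSet_le measurable_θ measurable_const) ?_ measurable_const
  exact continuous_coe_circle.measurable.comp (measurable_θ.const_mul 2)

lemma measurePreserving_G : MeasurePreserving G volume volume := by
  rw [funext G_eq, Measure.volume_eq_prod]
  refine (MeasurePreserving.id volume).skew_product
    (g := fun a b => b + twist a) (by unfold Function.uncurry; fun_prop) ?_
  exact ae_of_all _ fun a => (measurePreserving_add_right volume (twist a)).map_eq

lemma measurePreserving_F : MeasurePreserving F volume volume := by
  have : F = Prod.swap ∘ G ∘ Prod.swap := funext fun z => by
    rw [F_eq, Function.comp_apply, Function.comp_apply, G_eq]; rfl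
  rw [this]
  have hs : MeasurePreserving (Prod.swap : 𝕋 → 𝕋) volume volume := by
    rw [Measure.volume_eq_prod]; exact Measure.measurePreserving_swap
  exact hs.comp (measurePreserving_G.comp hs)

lemma measurePreserving_H : MeasurePreserving H volume volume :=
  measurePreserving_G.comp measurePreserving_F

/-- The reversing symmetry of the linked-twist map. -/
def Jc (z : 𝕋) : 𝕋 := (z.2, ((1 : ℝ) : AddCircle (2:ℝ)) - z.1)

/-- The inverse of the reversing symmetry. -/
def Ji (z : 𝕋) : 𝕋 := (((1 : ℝ) : AddCircle (2:ℝ)) - z.2, z.1)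

lemma Jc_Ji (z : 𝕋) : Jc (Ji z) = z := by simp [Jc, Ji]

lemma Ji_Jc (z : 𝕋) : Ji (Jc z) = z := by simp [Jc, Ji]

lemma measurePreserving_Jc : MeasurePreserving Jc volume volume := by
  have h1 : MeasurePreserving (Prod.map id (fun x => ((1 : ℝ) : AddCircle (2:ℝ)) - x) : 𝕋 → 𝕋)
      volume volume := by
    rw [Measure.volume_eq_prod]
    exact (MeasurePreserving.id volume).prod (Measure.measurePreserving_sub_left volume _)
  have hs : MeasurePreserving (Prod.swap : 𝕋 → 𝕋) volume volume := by
    rw [Measure.volume_eq_prod]; exact Measure.measurePreserving_swap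
  exact h1.comp hs

lemma measurePreserving_Ji : MeasurePreserving Ji volume volume := by
  have h1 : MeasurePreserving (Prod.map (fun x => ((1 : ℝ) : AddCircle (2:ℝ)) - x) id : 𝕋 → 𝕋)
      volume volume := by
    rw [Measure.volume_eq_prod]
    exact (Measure.measurePreserving_sub_left volume _).prod (MeasurePreserving.id volume)
  have hs : MeasurePreserving (Prod.swap : 𝕋 → 𝕋) volume volume := by
    rw [Measure.volume_eq_prod]; exact Measure.measurePreserving_swap
  exact h1.comp hs

/-- The lift of the reversing symmetry to the plane. -/
def Jt (z : ℝ × ℝ) : ℝ × ℝ := (z.2, 1 - z.1)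

lemma pr_Jt (z : ℝ × ℝ) : pr (Jt z) = Jc (pr z) := rfl

lemma shear_one_sub (y : ℝ) : shear (1 - y) = 2 - shear y := by
  obtain ⟨i, hi⟩ : ∃ i, ⌊y⌋ = i := ⟨_, rfl⟩
  have h1 := Int.floor_le y
  have h2 := Int.lt_floor_add_one y
  rw [hi] at h1 h2
  rcases Int.even_or_odd i with he | ho
  · rw [shear_of_even hi he]
    rcases eq_or_lt_of_le h1 with h | h
    · have : ⌊1 - y⌋ = 1 - i := by rw [← h, ← Int.cast_one, ← Int.cast_sub, Int.floor_intCast]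
      rw [shear_of_odd this (by rw [Int.odd_sub]; simp [he]), ← h]
      push_cast; ring
    · have : ⌊1 - y⌋ = -i := by
        rw [Int.floor_eq_iff]; push_cast; constructor <;> linarith
      rw [shear_of_even this he.neg]
      push_cast; ring
  · rw [shear_of_odd hi ho]
    rcases eq_or_lt_of_le h1 with h | h
    · have : ⌊1 - y⌋ = 1 - i := by rw [← h, ← Int.cast_one, ← Int.cast_sub, Int.floor_intCast]
      rw [shear_of_even this (by rw [Int.even_sub]; simp [ho]), ← h]
      push_cast; ring
    · have : ⌊1 - y⌋ = -i := by
        rw [Int.floor_eq_iff]; push_cast; constructor <;> linarith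
      rw [shear_of_odd this ho.neg]
      push_cast; ring

lemma twist_one_sub (x : AddCircle (2:ℝ)) :
    twist (((1 : ℝ) : AddCircle (2:ℝ)) - x) = - twist x := by
  obtain ⟨x, rfl⟩ := QuotientAddGroup.mk_surjective x
  have h : ((2 : ℝ) : AddCircle (2:ℝ)) = 0 := by simpa only [Int.cast_one, mul_one] using coe_two_mul_int 1
  change twist (((1 : ℝ) : AddCircle (2:ℝ)) - (x : AddCircle (2:ℝ))) = - twist (x : AddCircle (2:ℝ))
  rw [← AddCircle.coe_sub, twist_coe, twist_coe, shear_one_sub, AddCircle.coe_sub, h, zero_sub]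

lemma H_Jc_H (z : 𝕋) : H (Jc (H z)) = Jc z := by
  simp only [H_eq, Jc, twist_one_sub]
  ext
  · simp
  · simp only [add_neg_cancel_right]
    abel

/-- The inverse of the linked-twist map. -/
def Hi (z : 𝕋) : 𝕋 := Jc (H (Ji z))

lemma H_Hi (z : 𝕋) : H (Hi z) = z := by rw [Hi, H_Jc_H, Jc_Ji]

lemma H_injective : Function.Injective H := fun a b h => by
  have h1 : Jc a = Jc b := by rw [← H_Jc_H, h, H_Jc_H]
  rw [← Ji_Jc a, h1, Ji_Jc]

lemma Hi_H (z : 𝕋) : Hi (H z) = z := H_injective (H_Hi _)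

lemma measurePreserving_Hi : MeasurePreserving Hi volume volume :=
  measurePreserving_Jc.comp (measurePreserving_H.comp measurePreserving_Ji)

lemma measurePreserving_pr (a b : ℝ) : MeasurePreserving pr
    (volume.restrict (Set.Ioc a (a + 2) ×ˢ Set.Ioc b (b + 2))) volume := by
  rw [Measure.volume_eq_prod, Measure.volume_eq_prod, ← Measure.prod_restrict]
  exact (AddCircle.measurePreserving_mk 2 a).prod (AddCircle.measurePreserving_mk 2 b)

lemma volume_ball_inter_preimage_pr_le (z : ℝ × ℝ) {W : Set 𝕋} (hW : MeasurableSet W) :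
    volume (Metric.ball z 1 ∩ pr ⁻¹' W) ≤ volume W := by
  have h := (measurePreserving_pr (z.1 - 1) (z.2 - 1)).measure_preimage hW.nullMeasurableSet
  rw [← h, Measure.restrict_apply (continuous_pr.measurable hW), Set.inter_comm]
  refine measure_mono (Set.inter_subset_inter_right _ fun x hx => ?_)
  rw [← Prod.mk.eta (p := z), ← ball_prod_same, Real.ball_eq_Ioo, Real.ball_eq_Ioo] at hx
  obtain ⟨⟨h1, h2⟩, ⟨h3, h4⟩⟩ := hx
  exact ⟨⟨h1, by linarith⟩, ⟨h3, by linarith⟩⟩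

lemma volume_eq_zero_of_preimage_pr {W : Set 𝕋} (hW : MeasurableSet W)
    (h : volume (pr ⁻¹' W) = 0) : volume W = 0 := by
  rw [← (measurePreserving_pr 0 0).measure_preimage hW.nullMeasurableSet]
  exact le_antisymm ((Measure.restrict_apply_le _ _).trans h.le) zero_le

lemma ae_pr {p : 𝕋 → Prop} (h : ∀ᵐ ζ : 𝕋, p ζ) : ∀ᵐ z : ℝ × ℝ, p (pr z) := by
  obtain ⟨W, hsub, hW, hW0⟩ := exists_measurable_superset_of_null (ae_iff.1 h)
  have h1 : volume (pr ⁻¹' W) = 0 := by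
    refine measure_null_of_locally_null _ fun z _ => ?_
    refine ⟨Metric.ball z 1 ∩ pr ⁻¹' W, ?_, ?_⟩
    · rw [Set.inter_comm]
      exact inter_mem_nhdsWithin _ (Metric.ball_mem_nhds z one_pos)
    · exact le_antisymm ((volume_ball_inter_preimage_pr_le z hW).trans hW0.le) zero_le
  rw [ae_iff]
  exact measure_mono_null (fun z hz => hsub hz) h1

lemma measurePreserving_Ht : MeasurePreserving Ht volume volume := by
  have hG : MeasurePreserving (fun z : ℝ × ℝ => (z.1, z.2 + shear z.1)) volume volume := by
    rw [Measure.volume_eq_prod]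
    refine (MeasurePreserving.id volume).skew_product (g := fun a b => b + shear a)
      (by unfold Function.uncurry; fun_prop) ?_
    exact ae_of_all _ fun a => (measurePreserving_add_right volume (shear a)).map_eq
  have hs : MeasurePreserving (Prod.swap : ℝ × ℝ → ℝ × ℝ) volume volume := by
    rw [Measure.volume_eq_prod]; exact Measure.measurePreserving_swap
  exact hG.comp (hs.comp (hG.comp hs))

lemma lipschitzWith_Ht : LipschitzWith 7 Ht := by
  refine LipschitzWith.of_dist_le_mul fun u v => ?_
  have h1 : |u.1 - v.1| ≤ dist u v := by rw [Prod.dist_eq]; exact le_max_left _ _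
  have h2 : |u.2 - v.2| ≤ dist u v := by rw [Prod.dist_eq]; exact le_max_right _ _
  have hs : ∀ a b, |shear a - shear b| ≤ 2 * |a - b| := fun a b => by
    simpa [Real.dist_eq] using lipschitzWith_shear.dist_le_mul a b
  have h3 : |(Ht u).1 - (Ht v).1| ≤ 3 * dist u v := by
    rw [Ht_fst, Ht_fst, add_sub_add_comm]
    exact (abs_add_le _ _).trans (by linarith [hs u.2 v.2])
  have h4 : |(Ht u).2 - (Ht v).2| ≤ 7 * dist u v := by
    rw [Ht_snd, Ht_snd, add_sub_add_comm]
    exact (abs_add_le _ _).trans (by linarith [hs (Ht u).1 (Ht v).1])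
  rw [Prod.dist_eq, Real.dist_eq, Real.dist_eq, NNReal.coe_ofNat]
  have := dist_nonneg (x := u) (y := v)
  exact max_le (by linarith) h4

/-- Density one is pulled back by the lift. -/
lemma Dens1.of_Ht {A : Set (ℝ × ℝ)} (hA : MeasurableSet A) (hinv : Ht ⁻¹' A = A)
    {w : ℝ × ℝ} (n : ℕ) (h : Dens1 A (Ht^[n] w)) : Dens1 A w := by
  induction n with
  | zero => exact h
  | succ n ih =>
    refine ih ?_
    rw [Function.iterate_succ_apply'] at h
    refine h.of_le (C := 1) (L := 7) (ρ := 1) zero_le_one (by norm_num) one_pos fun r hr _ => ?_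
    have hm := measurePreserving_Ht.measure_preimage (Metric.isClosed_closedBall.measurableSet.diff
      hA : MeasurableSet (Metric.closedBall (Ht (Ht^[n] w)) (7 * r) \ A)).nullMeasurableSet
    rw [ENNReal.ofReal_one, one_mul, ← hm, Set.preimage_sdiff, hinv]
    refine measure_mono (Set.sdiff_subset_sdiff_left fun x hx => ?_)
    have h1 := lipschitzWith_Ht.dist_le_mul x (Ht^[n] w)
    rw [NNReal.coe_ofNat] at h1
    exact Metric.mem_closedBall.2 (h1.trans (by linarith [Metric.mem_closedBall.1 hx]))

lemma measurePreserving_Jt : MeasurePreserving Jt volume volume := by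
  have h1 : MeasurePreserving (Prod.map id (fun x => (1 : ℝ) - x) : ℝ × ℝ → ℝ × ℝ)
      volume volume := by
    rw [Measure.volume_eq_prod]
    exact (MeasurePreserving.id volume).prod (Measure.measurePreserving_sub_left volume _)
  have hs : MeasurePreserving (Prod.swap : ℝ × ℝ → ℝ × ℝ) volume volume := by
    rw [Measure.volume_eq_prod]; exact Measure.measurePreserving_swap
  exact h1.comp hs

lemma dist_Jt (u v : ℝ × ℝ) : dist (Jt u) (Jt v) = dist u v := by
  rw [Prod.dist_eq, Prod.dist_eq, max_comm]
  congr 1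
  simp only [Jt, Real.dist_eq]
  rw [sub_sub_sub_cancel_left, abs_sub_comm]

lemma Dens1.of_Jt {A : Set (ℝ × ℝ)} (hA : MeasurableSet A) {w : ℝ × ℝ}
    (h : Dens1 A (Jt w)) : Dens1 (Jt ⁻¹' A) w := by
  refine h.of_le (C := 1) (L := 1) (ρ := 1) zero_le_one one_pos one_pos fun r hr _ => ?_
  have hm := measurePreserving_Jt.measure_preimage (Metric.isClosed_closedBall.measurableSet.diff
    hA : MeasurableSet (Metric.closedBall (Jt w) r \ A)).nullMeasurableSet
  rw [ENNReal.ofReal_one, one_mul, one_mul, ← hm, Set.preimage_sdiff]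
  refine measure_mono (Set.sdiff_subset_sdiff_left fun x hx => ?_)
  exact Metric.mem_closedBall.2 ((dist_Jt x w).trans_le hx)

lemma measurable_iterate_H (n : ℕ) : Measurable H^[n] := measurePreserving_H.measurable.iterate n

lemma H_iterate_Hi (n : ℕ) (ζ : 𝕋) : H^[n] (Hi^[n] ζ) = ζ :=
  Function.LeftInverse.iterate (f := Hi) (g := H) H_Hi n ζ

/-- A measure estimate for first visits to a set `D`. -/
lemma volume_iUnion_le_of_visits {Y : ℕ → Set 𝕋} {D : Set 𝕋} (hY : ∀ n, MeasurableSet (Y n))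
    (hD : ∀ n, ∀ ζ ∈ Y n, H^[n] ζ ∈ D)
    (hdisj : ∀ m n ζ, ζ ∈ Y (m + (n + 1)) → H^[n + 1] ζ ∉ Y m) :
    volume (⋃ n, Y n) ≤ volume D := by
  have h1 : ∀ n, volume (Y n) = volume (Hi^[n] ⁻¹' Y n) := fun n =>
    ((measurePreserving_Hi.iterate n).measure_preimage (hY n).nullMeasurableSet).symm
  refine (measure_iUnion_le _).trans ?_
  simp_rw [h1]
  rw [← measure_iUnion]
  · refine measure_mono (Set.iUnion_subset fun n ζ hζ => ?_)
    have := hD n _ hζ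
    rwa [H_iterate_Hi] at this
  · refine (pairwise_disjoint_on _).2 fun m n hmn => Set.disjoint_left.2 fun ζ hm hn => ?_
    obtain ⟨k, rfl⟩ := Nat.exists_eq_add_of_lt hmn
    refine hdisj m k _ hn ?_
    rw [Set.mem_preimage] at hm
    rwa [add_assoc, add_comm m, Function.iterate_add_apply Hi, H_iterate_Hi]
  · exact fun n => (measurePreserving_Hi.iterate n).measurable (hY n)

/-- The open core of the square `S`. -/
def S0 : Set 𝕋 := {ζ | (0 < θ ζ.1 ∧ θ ζ.1 < 1) ∧ 0 < θ ζ.2 ∧ θ ζ.2 < 1}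

lemma measurableSet_S0 : MeasurableSet S0 := by
  have h1 : Measurable fun ζ : 𝕋 => θ ζ.1 := by fun_prop
  have h2 : Measurable fun ζ : 𝕋 => θ ζ.2 := by fun_prop
  exact (((measurableSet_lt measurable_const h1).inter (measurableSet_lt h1 measurable_const)).inter
    ((measurableSet_lt measurable_const h2).inter (measurableSet_lt h2 measurable_const)))

lemma measurableSet_S : MeasurableSet S := by
  have h1 : Measurable fun ζ : 𝕋 => θ ζ.1 := by fun_prop
  have h2 : Measurable fun ζ : 𝕋 => θ ζ.2 := by fun_prop
  exact (measurableSet_le h2 measurable_const).inter (measurableSet_le h1 measurable_const)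

lemma S0_subset_S : S0 ⊆ S := fun _ h => ⟨h.2.2.le, h.1.2.le⟩

lemma volume_S_diff_S0 : volume (S \ S0) = 0 := by
  set T : Set (AddCircle (2:ℝ)) := {0, ((1 : ℝ) : AddCircle (2:ℝ))}
  have hsing : ∀ x : AddCircle (2:ℝ), volume {x} = 0 := fun x => by
    rw [← Metric.closedBall_zero, AddCircle.volume_closedBall]; simp
  have hT : volume T = 0 := measure_union_null (hsing 0) (hsing _)
  have hmem : ∀ x : AddCircle (2:ℝ), θ x ≤ 1 → ¬ (0 < θ x ∧ θ x < 1) → x ∈ T := by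
    intro x h1 h2
    by_cases h : 0 < θ x
    · have : θ x = 1 := le_antisymm h1 (not_lt.1 fun h' => h2 ⟨h, h'⟩)
      rw [← coe_θ x, this]; exact Or.inr rfl
    · have : θ x = 0 := le_antisymm (not_lt.1 h) (θ_mem x).1
      rw [← coe_θ x, this]; exact Or.inl rfl
  refine measure_mono_null (t := T ×ˢ Set.univ ∪ Set.univ ×ˢ T) (fun ζ hζ => ?_) ?_
  · by_cases h : 0 < θ ζ.1 ∧ θ ζ.1 < 1
    · exact Or.inr ⟨trivial, hmem _ hζ.1.1 fun h' => hζ.2 ⟨h, h'⟩⟩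
    · exact Or.inl ⟨hmem _ hζ.1.2 h, trivial⟩
  · rw [measure_union_null_iff, Measure.volume_eq_prod, Measure.prod_prod, Measure.prod_prod, hT]
    simp

/-- The number of visits to the core between times `1` and `n`. -/
def cnt (ζ : 𝕋) : ℕ → ℕ
  | 0 => 0
  | n + 1 => cnt ζ n + S0.indicator (fun _ => 1) (H^[n + 1] ζ)

lemma cnt_add (ζ : 𝕋) (m n : ℕ) : cnt ζ (m + n) = cnt ζ m + cnt (H^[m] ζ) n := by
  induction n with
  | zero => rfl
  | succ n ih =>
    rw [← add_assoc, cnt, ih, cnt, ← Function.iterate_add_apply, add_assoc, add_assoc,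
      add_comm m (n + 1), add_right_comm n 1 m, add_comm n m]

lemma measurable_cnt (n : ℕ) : Measurable fun ζ => cnt ζ n := by
  induction n with
  | zero => exact measurable_const
  | succ n ih =>
    exact ih.add ((measurable_const.indicator measurableSet_S0).comp (measurable_iterate_H _))

/-- The points near the singular lines of the linked-twist map. -/
def Dset (ε : ℝ) : Set 𝕋 := {ζ | kap (θ ζ.2) < ε ∨ kap (θ (H ζ).1) < ε}

@[fun_prop]
lemma measurable_kap : Measurable kap := by
  unfold kap
  exact measurable_fract.min (measurable_const.sub measurable_fract)

lemma measurableSet_Dset (ε : ℝ) : MeasurableSet (Dset ε) := by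
  have h1 : Measurable fun ζ : 𝕋 => kap (θ (H ζ).1) := by
    have := measurePreserving_H.measurable
    fun_prop
  have h2 : Measurable fun ζ : 𝕋 => kap (θ ζ.2) := by fun_prop
  exact (measurableSet_lt h2 measurable_const).union (measurableSet_lt h1 measurable_const)

lemma volume_kap_lt_le (ε : ℝ) :
    volume {x : AddCircle (2:ℝ) | kap (θ x) < ε} ≤ ENNReal.ofReal (8 * ε) := by
  have hm : MeasurableSet {x : AddCircle (2:ℝ) | kap (θ x) < ε} :=
    measurableSet_lt (by fun_prop) measurable_const
  rw [← (AddCircle.measurePreserving_mk 2 0).measure_preimage hm.nullMeasurableSet,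
    Measure.restrict_apply (continuous_coe_circle.measurable hm)]
  have hsub : (fun x : ℝ => (x : AddCircle (2:ℝ))) ⁻¹' {x : AddCircle (2:ℝ) | kap (θ x) < ε} ∩
      Set.Ioc 0 (0 + 2) ⊆ ⋃ m ∈ Finset.range 4, Metric.ball (m : ℝ) ε := by
    rintro y ⟨hy, hy0, hy2⟩
    rw [Set.mem_preimage, Set.mem_ofPred_eq, kap_θ, kap, min_lt_iff] at hy
    have hf := Int.floor_add_fract y
    have h0 := Int.fract_nonneg y
    have h1 := Int.fract_lt_one y
    obtain ⟨k, hk⟩ : ∃ k : ℕ, ⌊y⌋ = k := ⟨⌊y⌋.toNat, (Int.toNat_of_nonneg (Int.floor_nonneg.2 hy0.le)).symm⟩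
    have hk2 : k ≤ 2 := by
      have : ⌊y⌋ < 3 := Int.floor_lt.2 (by push_cast; linarith)
      omega
    rw [hk, Int.cast_natCast] at hf
    rcases hy with hy | hy
    · refine Set.mem_biUnion (x := k) (Finset.mem_coe.2 (Finset.mem_range.2 (by omega))) ?_
      rw [Metric.mem_ball, Real.dist_eq, abs_lt]
      constructor <;> linarith
    · refine Set.mem_biUnion (x := k + 1) (Finset.mem_coe.2 (Finset.mem_range.2 (by omega))) ?_
      rw [Metric.mem_ball, Real.dist_eq, abs_lt]
      push_cast
      constructor <;> linarith
  refine (measure_mono hsub).trans ((measure_biUnion_finset_le _ _).trans ?_)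
  simp only [Real.volume_ball, Finset.sum_const, Finset.card_range, nsmul_eq_mul]
  rw [show (8 * ε : ℝ) = 4 * (2 * ε) by ring, ENNReal.ofReal_mul (by norm_num)]
  simp

lemma volume_Dset_le {ε : ℝ} (hε : 0 ≤ ε) : volume (Dset ε) ≤ ENNReal.ofReal (32 * ε) := by
  have hu : volume (Set.univ : Set (AddCircle (2:ℝ))) = ENNReal.ofReal 2 :=
    AddCircle.measure_univ 2
  have hm : MeasurableSet {x : AddCircle (2:ℝ) | kap (θ x) < ε} :=
    measurableSet_lt (by fun_prop) measurable_const
  have h1 : volume (Set.univ ×ˢ {x : AddCircle (2:ℝ) | kap (θ x) < ε} : Set 𝕋)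
      ≤ ENNReal.ofReal (16 * ε) := by
    rw [Measure.volume_eq_prod, Measure.prod_prod, hu, show (16 * ε : ℝ) = 2 * (8 * ε) by ring,
      ENNReal.ofReal_mul (by norm_num)]
    gcongr
    exact volume_kap_lt_le ε
  have h2 : volume (H ⁻¹' ({x : AddCircle (2:ℝ) | kap (θ x) < ε} ×ˢ Set.univ : Set 𝕋))
      ≤ ENNReal.ofReal (16 * ε) := by
    rw [measurePreserving_H.measure_preimage (hm.prod MeasurableSet.univ).nullMeasurableSet,
      Measure.volume_eq_prod, Measure.prod_prod, hu, show (16 * ε : ℝ) = (8 * ε) * 2 by ring,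
      ENNReal.ofReal_mul (by positivity)]
    gcongr
    exact volume_kap_lt_le ε
  rw [show (32 * ε : ℝ) = 16 * ε + 16 * ε by ring, ENNReal.ofReal_add (by positivity) (by positivity)]
  refine (measure_mono ?_).trans ((measure_union_le _ _).trans (add_le_add h1 h2))
  rintro ζ (h | h)
  · exact Or.inl ⟨trivial, h⟩
  · exact Or.inr ⟨h, trivial⟩

lemma volume_visit_le (k : ℕ) {D : Set 𝕋} (hD : MeasurableSet D) :
    volume (⋃ n, {ζ | ζ ∈ S0 ∧ cnt ζ n = k ∧ H^[n] ζ ∈ D}) ≤ volume D := by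
  refine volume_iUnion_le_of_visits (fun n => ?_) (fun n ζ hζ => hζ.2.2) fun m n ζ h1 h2 => ?_
  · exact measurableSet_S0.inter ((measurable_cnt n (measurableSet_singleton k)).inter
      (measurable_iterate_H n hD))
  · have h3 := h1.2.1
    rw [add_comm, cnt_add, h2.2.1, cnt, Set.indicator_of_mem h2.1] at h3
    omega

/-- The points whose orbit approaches the singular lines slowly. -/
def Slow (δ : ℝ) : Set 𝕋 := {ζ | θ ζ.2 < 1 ∧ ∀ n, H^[n] ζ ∉ Dset (δ / 4 ^ cnt ζ n)}

lemma measurableSet_Slow (δ : ℝ) : MeasurableSet (Slow δ) := by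
  have h2 : Measurable fun ζ : 𝕋 => θ ζ.2 := by fun_prop
  have hS : Slow δ = {ζ | θ ζ.2 < 1} ∩ ⋂ n, {ζ | H^[n] ζ ∈ Dset (δ / 4 ^ cnt ζ n)}ᶜ := by
    ext ζ
    simp [Slow]
  rw [hS]
  refine (measurableSet_lt h2 measurable_const).inter ?_
  refine MeasurableSet.iInter fun n => MeasurableSet.compl ?_
  have h3 : Measurable fun ζ : 𝕋 => δ / 4 ^ cnt ζ n :=
    (measurable_from_top (f := fun k : ℕ => δ / 4 ^ k)).comp (measurable_cnt n)
  have h4 := measurable_iterate_H n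
  have h5 := measurePreserving_H.measurable
  have h6 : Measurable fun ζ : 𝕋 => kap (θ (H^[n] ζ).2) := by fun_prop
  have h7 : Measurable fun ζ : 𝕋 => kap (θ (H (H^[n] ζ)).1) := by fun_prop
  exact (measurableSet_lt h6 h3).union (measurableSet_lt h7 h3)

lemma Kp_of_mem_Slow {δ : ℝ} {z : ℝ × ℝ} (h : pr z ∈ Slow δ) : Kp δ z := by
  refine ⟨cnt (pr z), rfl, (even_floor_iff _).2 h.1, fun n => ?_, fun n => ?_⟩
  · by_cases hn : H^[n + 1] (pr z) ∈ S0
    · refine Or.inr ⟨by rw [cnt, Set.indicator_of_mem hn], ?_⟩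
      rw [iterate_H_pr] at hn
      exact ⟨(even_floor_iff _).2 hn.1.2, (even_floor_iff _).2 hn.2.2⟩
    · exact Or.inl (by rw [cnt, Set.indicator_of_notMem hn, add_zero])
  · have := h.2 n
    rw [Dset, Set.mem_ofPred_eq, not_or, not_lt, not_lt, ← Function.iterate_succ_apply' H,
      iterate_H_pr, iterate_H_pr] at this
    simpa only [pr, kap_θ] using this

lemma exists_volume_S0_diff_Slow_lt {c : ℝ≥0∞} (hc : c ≠ 0) :
    ∃ δ : ℝ, 0 < δ ∧ volume (S0 \ Slow δ) < c := by
  obtain ⟨ε, hε0, hεc⟩ := ENNReal.lt_iff_exists_real_btwn.1 (pos_iff_ne_zero.2 hc)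
  have hε : 0 < ε := ENNReal.ofReal_pos.1 hεc.1
  refine ⟨ε / 64, by positivity, lt_of_le_of_lt ?_ hεc.2⟩
  have hs : Summable fun k : ℕ => 32 * (ε / 64 / 4 ^ k) := by
    have : (fun k : ℕ => 32 * (ε / 64 / 4 ^ k)) = fun k : ℕ => (ε / 2) * (1 / 4) ^ k := by
      ext k; rw [one_div, inv_pow]; ring
    rw [this]
    exact (summable_geometric_of_lt_one (by norm_num) (by norm_num)).mul_left _
  have ht : ∑' k : ℕ, 32 * (ε / 64 / 4 ^ k) = ε / 2 * (4 / 3) := by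
    have : (fun k : ℕ => 32 * (ε / 64 / 4 ^ k)) = fun k : ℕ => (ε / 2) * (1 / 4) ^ k := by
      ext k; rw [one_div, inv_pow]; ring
    rw [this, tsum_mul_left, tsum_geometric_of_lt_one (by norm_num) (by norm_num)]
    norm_num
  calc volume (S0 \ Slow (ε / 64))
      ≤ volume (⋃ k : ℕ, ⋃ n, {ζ | ζ ∈ S0 ∧ cnt ζ n = k ∧ H^[n] ζ ∈ Dset (ε / 64 / 4 ^ k)}) := by
        refine measure_mono fun ζ hζ => ?_
        have h := hζ.2
        simp only [Slow, Set.mem_ofPred_eq, not_and, not_forall, not_not] at h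
        obtain ⟨n, hn⟩ := h hζ.1.2.2
        exact Set.mem_iUnion.2 ⟨cnt ζ n, Set.mem_iUnion.2 ⟨n, hζ.1, rfl, hn⟩⟩
    _ ≤ ∑' k : ℕ, ENNReal.ofReal (32 * (ε / 64 / 4 ^ k)) := by
        refine (measure_iUnion_le _).trans (ENNReal.tsum_le_tsum fun k => ?_)
        exact (volume_visit_le k (measurableSet_Dset _)).trans (volume_Dset_le (by positivity))
    _ = ENNReal.ofReal (ε / 2 * (4 / 3)) := by
        rw [← ENNReal.ofReal_tsum_of_nonneg (fun k => by positivity) hs, ht]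
    _ ≤ ENNReal.ofReal ε := ENNReal.ofReal_le_ofReal (by linarith)

/-- Poincaré recurrence for the linked-twist map. -/
lemma ae_frequently_mem {W : Set 𝕋} (hW : MeasurableSet W) :
    ∀ᵐ ζ : 𝕋, ζ ∈ W → ∃ᶠ n in atTop, H^[n] ζ ∈ W :=
  measurePreserving_H.conservative.ae_mem_imp_frequently_image_mem hW.nullMeasurableSet

lemma measurableSet_frequently {W : Set 𝕋} (hW : MeasurableSet W) :
    MeasurableSet {ζ | ∃ᶠ n in atTop, H^[n] ζ ∈ W} := by
  simp only [frequently_atTop, Set.ofPred_forall, Set.ofPred_exists]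
  refine MeasurableSet.iInter fun N => MeasurableSet.iUnion fun n => ?_
  exact (MeasurableSet.const _).inter (measurable_iterate_H n hW)

/-- The points of the square at distance at least `ε` from its boundary. -/
def core (ε : ℝ) : Set 𝕋 := S0 ∩ {ζ | ε ≤ kap (θ ζ.1) ∧ ε ≤ kap (θ ζ.2)}

lemma measurableSet_core (ε : ℝ) : MeasurableSet (core ε) := by
  have h1 : Measurable fun ζ : 𝕋 => kap (θ ζ.1) := by fun_prop
  have h2 : Measurable fun ζ : 𝕋 => kap (θ ζ.2) := by fun_prop
  exact measurableSet_S0.inter ((measurableSet_le measurable_const h1).inter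
    (measurableSet_le measurable_const h2))

/-- The points returning infinitely often to a fixed core of the square. -/
def Recur : Set 𝕋 := {ζ | ∃ k : ℕ, ∃ᶠ n in atTop, H^[n] ζ ∈ core (1 / (k + 1))}

lemma measurableSet_Recur : MeasurableSet Recur := by
  rw [Recur, Set.ofPred_exists]
  exact MeasurableSet.iUnion fun k => measurableSet_frequently (measurableSet_core _)

lemma ae_mem_Recur : ∀ᵐ ζ : 𝕋, ζ ∈ S0 → ζ ∈ Recur := by
  filter_upwards [ae_all_iff.2 fun k : ℕ => ae_frequently_mem (measurableSet_core (1 / (k + 1)))]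
    with ζ hζ h0
  have hpos : ∀ y : ℝ, 0 < y ∧ y < 1 → 0 < kap y := fun y hy => by
    rw [kap, Int.fract_eq_self.2 ⟨hy.1.le, hy.2⟩]
    exact lt_min hy.1 (by linarith [hy.2])
  obtain ⟨k, hk⟩ := exists_nat_one_div_lt (lt_min (hpos _ h0.1) (hpos _ h0.2))
  exact ⟨k, hζ k ⟨h0, (hk.trans_le (min_le_left _ _)).le, (hk.trans_le (min_le_right _ _)).le⟩⟩

lemma exists_Rec_of_mem_Recur {z : ℝ × ℝ} (h : pr z ∈ Recur) : ∃ ε > 0, Rec ε z := by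
  obtain ⟨k, hk⟩ := h
  refine ⟨1 / (k + 1), by positivity, hk.mono fun n hn => ?_⟩
  rw [iterate_H_pr] at hn
  obtain ⟨⟨h1, h2⟩, h3, h4⟩ := hn
  rw [pr, kap_θ] at h3 h4
  exact ⟨⟨(even_floor_iff _).2 h1.2, h3⟩, (even_floor_iff _).2 h2.2, h4⟩

lemma dist_pr_le (u v : ℝ × ℝ) : dist (pr u) (pr v) ≤ dist u v := by
  have h : ∀ a b : ℝ, dist (a : AddCircle (2:ℝ)) (b : AddCircle (2:ℝ)) ≤ dist a b := fun a b => by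
    rw [dist_eq_norm, dist_eq_norm, ← AddCircle.coe_sub]
    exact QuotientAddGroup.norm_mk_le_norm
  exact max_le_max (h _ _) (h _ _)

/-- The recurrent points whose orbit approaches the singular lines slowly. -/
def Good (δ : ℝ) : Set 𝕋 := Slow δ ∩ Recur

lemma measurableSet_Good (δ : ℝ) : MeasurableSet (Good δ) :=
  (measurableSet_Slow δ).inter measurableSet_Recur

lemma exists_Slope {δ : ℝ} (hδ : 0 < δ) {z : ℝ × ℝ} (hz : pr z ∈ Good δ) : ∃ s, Slope δ z s := by
  obtain ⟨ε, hε, hr⟩ := exists_Rec_of_mem_Recur hz.2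
  exact exists_slope hε hδ hr (Kp_of_mem_Slow hz.1)

/-- Density one of an invariant set is transported along leaves. -/
lemma Dens1.transport {A : Set 𝕋} (hA : MeasurableSet A) (hinv : H ⁻¹' A = A) {δ : ℝ}
    (hδ : 0 < δ) {z w : ℝ × ℝ} (hz : pr z ∈ Good δ) (hd : Dens1 (pr ⁻¹' (Good δ ∩ A)) z)
    (hP : Phi w = Phi z) (hw : |w.1 - z.1| ≤ δ / 6) : Dens1 (pr ⁻¹' A) w := by
  obtain ⟨ρ, hρ, hρδ, hρ1⟩ : ∃ ρ : ℝ, 0 < ρ ∧ ρ ≤ δ / 4 ∧ ρ ≤ 1 / 4 :=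
    ⟨min (δ / 4) (1 / 4), by positivity, min_le_left _ _, min_le_right _ _⟩
  have hs : ∀ u, ∃ s, pr u ∈ Good δ → Slope δ u s := fun u => by
    by_cases h : pr u ∈ Good δ
    · exact (exists_Slope hδ h).imp fun s hs _ => hs
    · exact ⟨0, fun h' => absurd h' h⟩
  choose σ₀ hσ₀ using hs
  have hlip : LipschitzOnWith (3 / δ).toNNReal σ₀ (pr ⁻¹' Good δ ∩ Metric.ball z ρ) := by
    refine LipschitzOnWith.of_dist_le_mul fun u hu v hv => ?_
    rw [Real.coe_toNNReal _ (by positivity)]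
    refine (hσ₀ u hu.1).abs_sub_le hδ (hσ₀ v hv.1) ?_
    have h1 : |u.1 - v.1| ≤ dist u v := by rw [Prod.dist_eq]; exact le_max_left _ _
    have h2 := dist_triangle_right u v z
    linarith [Metric.mem_ball.1 hu.2, Metric.mem_ball.1 hv.2]
  obtain ⟨σ, hσ, heq⟩ := hlip.extend_real
  have hσS : ∀ u, pr u ∈ Good δ → u ∈ Metric.ball z ρ → Slope δ u (σ u) := fun u h1 h2 => by
    rw [← heq ⟨h1, h2⟩]; exact hσ₀ u h1
  have hzS := hσS z hz (Metric.mem_ball_self hρ)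
  obtain ⟨t, ht⟩ : ∃ t, w.1 - z.1 = t := ⟨_, rfl⟩
  rw [ht] at hw
  have htδ : |t| < δ := by linarith
  have hwz : slide t σ z = w := by
    have h1 : z.1 + t = w.1 := by linarith
    have h2 := (hzS.2.2 t htδ w.2).1 (by rw [h1]; exact hP)
    exact Prod.ext h1 (by rw [h2, mul_comm]; rfl)
  have htK : |t| * ((3 / δ).toNNReal : ℝ) ≤ 1 / 2 := by
    rw [Real.coe_toNNReal _ (by positivity), mul_div_assoc', div_le_iff₀ hδ]
    linarith
  have hL := lipschitzWith_slide hσ htK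
  have hAL := antilipschitzWith_slide hσ htK
  set E := pr ⁻¹' (Good δ ∩ A) ∩ Metric.ball z ρ with hE
  have hball : Metric.ball z ρ ⊆ Metric.ball z 1 := Metric.ball_subset_ball (by linarith)
  have hnull : volume (E \ (pr ∘ slide t σ) ⁻¹' A) = 0 := by
    have := volume_inter_preimage_diff_eq_zero measurePreserving_H hA hinv (E := E) (f := pr)
      (g := pr ∘ slide t σ) (C := 4) (fun W hW => ?_) (fun W hW => ?_) fun u hu => ?_
    · rwa [Set.inter_eq_left.2 fun u hu => hu.1.2] at this
    · refine (measure_mono (t := Metric.ball z 1 ∩ pr ⁻¹' W)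
        fun u hu => ⟨hball hu.1.2, hu.2⟩).trans ((volume_ball_inter_preimage_pr_le z hW).trans ?_)
      exact le_mul_of_one_le_left' (by norm_num)
    · refine (measure_mono (t := slide t σ ⁻¹' (Metric.ball w 1 ∩ pr ⁻¹' W))
        fun u hu => ⟨?_, hu.2⟩).trans ((volume_preimage_le hAL _).trans ?_)
      · rw [← hwz]
        have h1 := hL.dist_le_mul u z
        rw [NNReal.coe_ofNat] at h1
        exact Metric.mem_ball.2 (h1.trans_lt (by linarith [Metric.mem_ball.1 hu.1.2]))
      · rw [ENNReal.coe_ofNat]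
        gcongr
        exact volume_ball_inter_preimage_pr_le w hW
    · obtain ⟨ε, hε, hr⟩ := exists_Rec_of_mem_Recur hu.1.1.2
      have h1 := tendsto_sub_of_Phi_eq hε (Or.inl hr)
        ((hσS u hu.1.1 hu.2).Phi_slide htδ).symm
      refine squeeze_zero (fun n => dist_nonneg) (fun n => ?_) (tendsto_zero_iff_norm_tendsto_zero.1 h1)
      rw [Function.comp_apply, iterate_H_pr, iterate_H_pr]
      refine (dist_pr_le _ _).trans_eq ?_
      rw [dist_comm, dist_eq_norm]
  refine (hd.inter_ball hρ).of_le (C := 4) (L := 2) (ρ := 1) (by norm_num) two_pos one_pos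
    fun r hr _ => ?_
  have hsub : Metric.closedBall w r \ pr ⁻¹' A ⊆ slide t σ ''
      ((Metric.closedBall z (2 * r) \ E) ∪ (E \ (pr ∘ slide t σ) ⁻¹' A)) := by
    rintro x ⟨hx, hxA⟩
    obtain ⟨u, rfl⟩ := slide_surjective hσ htK x
    refine ⟨u, ?_, rfl⟩
    by_cases huE : u ∈ E
    · exact Or.inr ⟨huE, hxA⟩
    · refine Or.inl ⟨?_, huE⟩
      have h1 := hAL.le_mul_dist u z
      rw [hwz, NNReal.coe_ofNat] at h1
      exact Metric.mem_closedBall.2 (h1.trans (by linarith [Metric.mem_closedBall.1 hx]))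
  refine (measure_mono hsub).trans ((volume_image_le hL _).trans ?_)
  rw [ENNReal.ofReal_ofNat]
  exact mul_le_mul_right ((measure_union_le _ _).trans_eq (by rw [hnull, add_zero])) _

lemma preimage_Ht_preimage_pr {A : Set 𝕋} (hinv : H ⁻¹' A = A) :
    Ht ⁻¹' (pr ⁻¹' A) = pr ⁻¹' A := by
  ext z
  rw [Set.mem_preimage, Set.mem_preimage, ← H_pr, ← Set.mem_preimage, hinv, Set.mem_preimage]

/-- An invariant set which is not negligible in the square has density one at every point of some
level set of `Phi`. -/
lemma exists_forall_dens1 {A : Set 𝕋} (hA : MeasurableSet A) (hinv : H ⁻¹' A = A)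
    (hpos : volume (A ∩ S0) ≠ 0) : ∃ p, ∀ w, Phi w = p → Dens1 (pr ⁻¹' A) w := by
  obtain ⟨δ, hδ, hlt⟩ := exists_volume_S0_diff_Slow_lt hpos
  have hB : MeasurableSet (Good δ ∩ A) := (measurableSet_Good δ).inter hA
  have hBpos : volume (Good δ ∩ A) ≠ 0 := fun h0 => by
    refine hlt.not_ge ?_
    have hN : volume {ζ | ¬ (ζ ∈ S0 → ζ ∈ Recur)} = 0 := ae_iff.1 ae_mem_Recur
    have hsub : A ∩ S0 ⊆ ((S0 \ Slow δ) ∪ {ζ | ¬ (ζ ∈ S0 → ζ ∈ Recur)}) ∪ (Good δ ∩ A) := by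
      rintro ζ ⟨h1, h2⟩
      by_cases h3 : ζ ∈ Slow δ
      · by_cases h4 : ζ ∈ Recur
        · exact Or.inr ⟨⟨h3, h4⟩, h1⟩
        · exact Or.inl (Or.inr fun h5 => h4 (h5 h2))
      · exact Or.inl (Or.inl ⟨h2, h3⟩)
    refine (measure_mono hsub).trans ((measure_union_le _ _).trans ?_)
    rw [h0, add_zero]
    exact (measure_union_le _ _).trans_eq (by rw [hN, add_zero])
  have hfreq : ∃ᶠ z in ae (volume : Measure (ℝ × ℝ)), pr z ∈ Good δ ∩ A := fun h => by
    refine hBpos (volume_eq_zero_of_preimage_pr hB ?_)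
    exact measure_mono_null (fun z hz => not_not_intro hz) (ae_iff.1 h)
  have hdens : ∀ᵐ z : ℝ × ℝ, ∀ n, pr (Ht^[n] z) ∈ Good δ ∩ A →
      Dens1 (pr ⁻¹' (Good δ ∩ A)) (Ht^[n] z) :=
    ae_all_iff.2 fun n => (measurePreserving_Ht.iterate n).quasiMeasurePreserving.ae
      (ae_dens1 (continuous_pr.measurable hB))
  obtain ⟨z, hzB, hzd, hzf⟩ := (hfreq.and_eventually (hdens.and (ae_pr (ae_frequently_mem hB)))).exists
  obtain ⟨ε, hε, hr⟩ := exists_Rec_of_mem_Recur hzB.1.2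
  refine ⟨Phi z, fun w hw => ?_⟩
  have h1 := tendsto_sub_of_Phi_eq hε (Or.inl hr) hw.symm
  have h2 : ∀ᶠ n in atTop, ‖Ht^[n] w - Ht^[n] z‖ < δ / 6 :=
    (tendsto_zero_iff_norm_tendsto_zero.1 h1).eventually (gt_mem_nhds (by positivity))
  obtain ⟨n, hn1, hn2⟩ := ((hzf hzB).and_eventually h2).exists
  rw [iterate_H_pr] at hn1
  refine Dens1.of_Ht (continuous_pr.measurable hA) (preimage_Ht_preimage_pr hinv) n ?_
  refine (hzd n hn1).transport hA hinv hδ hn1.1 (Phi_iterate_eq hw n) ?_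
  exact (le_max_left _ _).trans hn2.le

lemma isCompact_level (a b p : ℝ) : IsCompact {z : ℝ × ℝ | z.1 ∈ Set.Icc a b ∧ Phi z = p} := by
  have hg := Real.goldenRatio_pos
  refine (isCompact_Icc (a := a) (b := b)).prod (isCompact_Icc
    (a := (p - PhiBd - b) / Real.goldenRatio) (b := (p + PhiBd - a) / Real.goldenRatio))
    |>.of_isClosed_subset ?_ fun z hz => ⟨hz.1, ?_⟩
  · exact (isClosed_Icc.preimage continuous_fst).inter (isClosed_eq continuous_Phi continuous_const)
  · have h1 := abs_le.1 (abs_Phi_sub_ell_le z)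
    rw [hz.2, ell] at h1
    rw [Set.mem_Icc, div_le_iff₀ hg, le_div_iff₀ hg]
    constructor <;> linarith [hz.1.1, hz.1.2]

/-- Stable and unstable level sets intersect. -/
lemma exists_Phi_eq_and_Phi_Jt_eq (p q : ℝ) : ∃ w, Phi w = p ∧ Phi (Jt w) = q := by
  have hg := Real.one_lt_goldenRatio
  have hg2 := Real.goldenRatio_sq
  have hJc : Continuous fun z => Phi (Jt z) := by unfold Jt; fun_prop
  have hJ : ∀ z, |Phi (Jt z) - (z.2 + Real.goldenRatio * (1 - z.1))| ≤ PhiBd := fun z =>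
    abs_Phi_sub_ell_le (Jt z)
  have hI : ∀ z, |Phi z - (z.1 + Real.goldenRatio * z.2)| ≤ PhiBd := abs_Phi_sub_ell_le
  set g := Real.goldenRatio
  -- along the level set of `p`, the value of `Phi ∘ Jt` is close to an affine function of `z.1`
  have haff : ∀ z, Phi z = p → |g * Phi (Jt z) - (p + g ^ 2 - (1 + g ^ 2) * z.1)| ≤
      (1 + g) * PhiBd := fun z hz => by
    have h1 := hI z
    have h2 := hJ z
    rw [hz] at h1
    rw [abs_le] at h1 h2 ⊢
    constructor <;> nlinarith
  obtain ⟨x₀, hx₀⟩ : ∃ x₀ : ℝ, p + g ^ 2 - (1 + g ^ 2) * x₀ = (1 + g) * PhiBd + g * q :=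
    ⟨(p + g ^ 2 - ((1 + g) * PhiBd + g * q)) / (1 + g ^ 2), by field_simp; ring⟩
  obtain ⟨x₁, hx₁⟩ : ∃ x₁ : ℝ, p + g ^ 2 - (1 + g ^ 2) * x₁ = g * q - (1 + g) * PhiBd :=
    ⟨(p + g ^ 2 - (g * q - (1 + g) * PhiBd)) / (1 + g ^ 2), by field_simp; ring⟩
  have hlow : ∀ z, Phi z = p → z.1 ≤ x₀ → q ≤ Phi (Jt z) := fun z hz hzx => by
    have h1 := abs_le.1 (haff z hz)
    have h2 : (1 + g ^ 2) * z.1 ≤ (1 + g ^ 2) * x₀ := by gcongr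
    have h3 : g * q ≤ g * Phi (Jt z) := by linarith
    exact le_of_mul_le_mul_left h3 (by linarith)
  have hhigh : ∀ z, Phi z = p → q ≤ Phi (Jt z) → z.1 ≤ x₁ := fun z hz hzq => by
    have h1 := abs_le.1 (haff z hz)
    have h2 : g * q ≤ g * Phi (Jt z) := by gcongr
    have h3 : (1 + g ^ 2) * z.1 ≤ (1 + g ^ 2) * x₁ := by linarith
    exact le_of_mul_le_mul_left h3 (by positivity)
  obtain ⟨y₀, hy₀⟩ := exists_Phi_eq x₀ p
  have hZ0 := hlow (x₀, y₀) hy₀ le_rfl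
  obtain ⟨z₁, ⟨⟨hz₁I, hz₁p⟩, hz₁q⟩, hz₁max⟩ := ((isCompact_level x₀ x₁ p).inter_right
    (isClosed_le continuous_const hJc)).exists_isMaxOn (f := Prod.fst)
    ⟨(x₀, y₀), ⟨⟨le_rfl, hhigh _ hy₀ hZ0⟩, hy₀⟩, hZ0⟩ continuous_fst.continuousOn
  have hright : ∀ z, Phi z = p → z₁.1 < z.1 → Phi (Jt z) < q := fun z hz hzx => by
    by_contra! h
    exact hzx.not_ge (hz₁max ⟨⟨⟨hz₁I.1.trans hzx.le, hhigh z hz h⟩, hz⟩, h⟩)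
  obtain ⟨y₃, hy₃⟩ := exists_Phi_eq (z₁.1 + 1) p
  obtain ⟨z₂, ⟨⟨hz₂I, hz₂p⟩, hz₂q⟩, hz₂min⟩ := ((isCompact_level z₁.1 (z₁.1 + 1) p).inter_right
    (isClosed_le hJc continuous_const)).exists_isMinOn (f := Prod.fst)
    ⟨(z₁.1 + 1, y₃), ⟨⟨by simp, le_rfl⟩, hy₃⟩, (hright (z₁.1 + 1, y₃) hy₃ (by simp)).le⟩
    continuous_fst.continuousOn
  have hx : z₂.1 = z₁.1 := by
    by_contra hne
    have hlt : z₁.1 < z₂.1 := lt_of_le_of_ne hz₂I.1 (Ne.symm hne)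
    obtain ⟨x, h1, h2⟩ := exists_between hlt
    obtain ⟨y, hy⟩ := exists_Phi_eq x p
    exact h2.not_ge (hz₂min (a := (x, y))
      ⟨⟨⟨h1.le, h2.le.trans hz₂I.2⟩, hy⟩, (hright (x, y) hy h1).le⟩)
  obtain ⟨x, a⟩ := z₁
  obtain ⟨x', b⟩ := z₂
  obtain rfl : x' = x := hx
  obtain ⟨y, hy, hyq⟩ := intermediate_value_uIcc (a := b) (b := a)
    (f := fun y => Phi (Jt (x', y))) (hJc.comp (Continuous.prodMk_right x')).continuousOn
    (Set.Icc_subset_uIcc ⟨hz₂q, hz₁q⟩)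
  refine ⟨(x', y), ?_, hyq⟩
  have hmono : Monotone fun y => Phi (x', y) := fun y y' h => Phi_mono ⟨le_rfl, h⟩
  rcases Set.mem_uIcc.1 hy with ⟨h1, h2⟩ | ⟨h1, h2⟩
  · exact le_antisymm ((hmono h2).trans_eq hz₁p) (hz₂p.symm.trans_le (hmono h1))
  · exact le_antisymm ((hmono h2).trans_eq hz₂p) (hz₁p.symm.trans_le (hmono h1))

lemma θ_one_sub {x : AddCircle (2:ℝ)} (h : 0 < θ (((1 : ℝ) : AddCircle (2:ℝ)) - x) ∧
    θ (((1 : ℝ) : AddCircle (2:ℝ)) - x) < 1) : 0 < θ x ∧ θ x < 1 := by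
  have h1 : x = ((1 - θ (((1 : ℝ) : AddCircle (2:ℝ)) - x) : ℝ) : AddCircle (2:ℝ)) := by
    rw [AddCircle.coe_sub, coe_θ, sub_sub_cancel]
  set c := θ (((1 : ℝ) : AddCircle (2:ℝ)) - x)
  have h2 : ⌊(1 - c) / 2⌋ = 0 := by
    rw [Int.floor_eq_iff]; push_cast; constructor <;> linarith
  rw [h1, θ_coe, h2]
  push_cast
  constructor <;> linarith

lemma H_Ji_H (ζ : 𝕋) : H (Ji (H ζ)) = Ji ζ := by
  have h : Jc (H (Ji (H ζ))) = ζ := Hi_H ζ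
  rw [← Ji_Jc (H (Ji (H ζ))), h]

/-- Two disjoint invariant sets cannot both have positive measure in the square. -/
lemma volume_inter_S0_eq_zero_of_disjoint {A B : Set 𝕋} (hA : MeasurableSet A)
    (hB : MeasurableSet B) (hAinv : H ⁻¹' A = A) (hBinv : H ⁻¹' B = B) (hd : Disjoint A B) :
    volume (A ∩ S0) = 0 ∨ volume (B ∩ S0) = 0 := by
  by_contra! hc
  obtain ⟨p, hp⟩ := exists_forall_dens1 hA hAinv hc.1
  have hBJ : MeasurableSet (Ji ⁻¹' B) := measurePreserving_Ji.measurable hB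
  have hBJinv : H ⁻¹' (Ji ⁻¹' B) = Ji ⁻¹' B := by
    ext ζ
    change Ji (H ζ) ∈ B ↔ Ji ζ ∈ B
    rw [← H_Ji_H ζ, ← Set.mem_preimage (f := H), hBinv]
  have hBJpos : volume (Ji ⁻¹' B ∩ S0) ≠ 0 := fun h0 => by
    refine hc.2 ?_
    rw [← measurePreserving_Ji.measure_preimage (hB.inter measurableSet_S0).nullMeasurableSet]
    have hsub : Ji ⁻¹' (B ∩ S0) ⊆ Ji ⁻¹' B ∩ S0 := fun ζ hζ =>
      ⟨hζ.1, hζ.2.2, θ_one_sub hζ.2.1⟩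
    exact measure_mono_null hsub h0
  obtain ⟨q, hq⟩ := exists_forall_dens1 hBJ hBJinv hBJpos
  obtain ⟨w, hwp, hwq⟩ := exists_Phi_eq_and_Phi_Jt_eq p q
  refine (hp w hwp).false_of_disjoint
    (Dens1.of_Jt (continuous_pr.measurable hBJ) (hq (Jt w) hwq)) ?_
  refine Set.disjoint_left.2 fun z hz1 hz2 => Set.disjoint_left.1 hd hz1 ?_
  have : Ji (pr (Jt z)) ∈ B := hz2
  rwa [pr_Jt, Ji_Jc] at this

lemma rtn_spec {T : 𝕋 → 𝕋} {ζ : 𝕋} (h : ∃ n, 1 ≤ n ∧ T^[n] ζ ∈ S) :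
    1 ≤ rtn T ζ ∧ T^[rtn T ζ] ζ ∈ S :=
  Nat.sInf_mem (s := {n : ℕ | 1 ≤ n ∧ T^[n] ζ ∈ S}) h

lemma rtn_le {T : 𝕋 → 𝕋} {ζ : 𝕋} {n : ℕ} (h1 : 1 ≤ n) (h2 : T^[n] ζ ∈ S) : rtn T ζ ≤ n :=
  Nat.sInf_le (s := {n : ℕ | 1 ≤ n ∧ T^[n] ζ ∈ S}) ⟨h1, h2⟩

lemma exists_of_rtn_ne_zero {T : 𝕋 → 𝕋} {ζ : 𝕋} (h : rtn T ζ ≠ 0) :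
    ∃ n, 1 ≤ n ∧ T^[n] ζ ∈ S :=
  Nat.nonempty_of_pos_sInf (Nat.pos_of_ne_zero h)

lemma rtn_eq_succ_iff {T : 𝕋 → 𝕋} {ζ : 𝕋} {n : ℕ} :
    rtn T ζ = n + 1 ↔ T^[n + 1] ζ ∈ S ∧ ∀ m < n, T^[m + 1] ζ ∉ S := by
  constructor
  · intro h
    have h1 := rtn_spec (exists_of_rtn_ne_zero (T := T) (ζ := ζ) (by omega))
    rw [h] at h1
    refine ⟨h1.2, fun m hm hS => ?_⟩
    have := rtn_le (by omega) hS
    omega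
  · rintro ⟨h1, h2⟩
    have h3 := rtn_spec ⟨n + 1, by omega, h1⟩
    have h4 := rtn_le (by omega) h1
    by_contra hne
    refine h2 (rtn T ζ - 1) (by omega) ?_
    rw [Nat.sub_add_cancel h3.1]
    exact h3.2

lemma measurable_rtn : Measurable (rtn H) := by
  have h1 : ∀ n, MeasurableSet (rtn H ⁻¹' {n + 1}) := fun n => by
    have : rtn H ⁻¹' {n + 1} = H^[n + 1] ⁻¹' S ∩ ⋂ m, ⋂ (_ : m < n), (H^[m + 1] ⁻¹' S)ᶜ := by
      ext ζ
      simp only [Set.mem_preimage, Set.mem_singleton_iff, rtn_eq_succ_iff, Set.mem_inter_iff,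
        Set.mem_iInter, Set.mem_compl_iff]
    rw [this]
    exact (measurable_iterate_H _ measurableSet_S).inter (MeasurableSet.iInter fun m =>
      MeasurableSet.iInter fun _ => (measurable_iterate_H _ measurableSet_S).compl)
  refine measurable_to_countable' fun n => ?_
  rcases n with - | n
  · have : rtn H ⁻¹' {0} = (⋃ n, rtn H ⁻¹' {n + 1})ᶜ := by
      ext ζ
      simp only [Set.mem_preimage, Set.mem_singleton_iff, Set.mem_compl_iff, Set.mem_iUnion,
        not_exists]
      refine ⟨fun h n => by omega, fun h => ?_⟩
      by_contra hne
      exact h (rtn H ζ - 1) (by omega)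
    rw [this]
    exact (MeasurableSet.iUnion h1).compl
  · exact h1 n

lemma measurable_retMap : Measurable (retMap H) := fun B hB => by
  have : retMap H ⁻¹' B = ⋃ n, rtn H ⁻¹' {n} ∩ H^[n] ⁻¹' B := by
    ext ζ
    simp [retMap]
  rw [this]
  exact MeasurableSet.iUnion fun n =>
    (measurable_rtn (measurableSet_singleton n)).inter (measurable_iterate_H n hB)

lemma ae_rtn_ne_zero : ∀ᵐ ζ : 𝕋, ζ ∈ S → rtn H ζ ≠ 0 := by
  filter_upwards [ae_frequently_mem measurableSet_S] with ζ hζ hS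
  obtain ⟨n, hn, hnS⟩ := frequently_atTop.1 (hζ hS) 1
  have := rtn_spec ⟨n, hn, hnS⟩
  omega

lemma volume_preimage_retMap_inter_le {B : Set 𝕋} (hB : MeasurableSet B) :
    volume (retMap H ⁻¹' B ∩ S) ≤ volume (B ∩ S) := by
  set Y : ℕ → Set 𝕋 := fun n => {ζ | ζ ∈ S ∧ (rtn H ζ = n ∧ rtn H ζ ≠ 0) ∧ H^[n] ζ ∈ B}
  have hY : ∀ n, MeasurableSet (Y n) := fun n =>
    measurableSet_S.inter (((measurable_rtn (measurableSet_singleton n)).inter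
      (measurable_rtn (measurableSet_singleton 0).compl)).inter (measurable_iterate_H n hB))
  have hae : volume {ζ | ¬ (ζ ∈ S → rtn H ζ ≠ 0)} = 0 := ae_iff.1 ae_rtn_ne_zero
  have hsub : retMap H ⁻¹' B ∩ S ⊆ (⋃ n, Y n) ∪ {ζ | ¬ (ζ ∈ S → rtn H ζ ≠ 0)} := by
    rintro ζ ⟨hζB, hζS⟩
    by_cases h : rtn H ζ = 0
    · exact Or.inr fun h' => h' hζS h
    · exact Or.inl (Set.mem_iUnion.2 ⟨rtn H ζ, hζS, ⟨rfl, h⟩, hζB⟩)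
  refine (measure_mono hsub).trans ((measure_union_le _ _).trans ?_)
  rw [hae, add_zero]
  refine volume_iUnion_le_of_visits hY (fun n ζ hζ => ⟨hζ.2.2, ?_⟩) fun m n ζ h1 h2 => ?_
  · have := (rtn_spec (exists_of_rtn_ne_zero hζ.2.1.2)).2
    rwa [hζ.2.1.1] at this
  · have h3 := rtn_le (by omega) h2.1
    have h4 := h1.2.1.1
    have h5 := h2.2.1
    omega

lemma measurePreserving_retMap :
    MeasurePreserving (retMap H) ((volume : Measure 𝕋).restrict S)
      ((volume : Measure 𝕋).restrict S) := by
  refine ⟨measurable_retMap, Measure.eq_of_le_of_measure_univ_eq ?_ ?_⟩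
  · refine Measure.le_iff.2 fun B hB => ?_
    rw [Measure.map_apply measurable_retMap hB, Measure.restrict_apply (measurable_retMap hB),
      Measure.restrict_apply hB]
    exact volume_preimage_retMap_inter_le hB
  · rw [Measure.map_apply measurable_retMap MeasurableSet.univ, Set.preimage_univ]

lemma volume_S : volume S = 1 := by
  have h1 : volume S = volume S0 := by
    rw [← measure_sdiff_add_inter (s := S) measurableSet_S0, volume_S_diff_S0, zero_add,
      Set.inter_eq_right.2 S0_subset_S]
  have hθ : ∀ y ∈ Set.Ioc (0 : ℝ) (0 + 2), (0 < θ (y : AddCircle (2:ℝ)) ∧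
      θ (y : AddCircle (2:ℝ)) < 1) ↔ y ∈ Set.Ioo (0 : ℝ) 1 := fun y hy => by
    rw [zero_add] at hy
    rcases eq_or_lt_of_le hy.2 with rfl | hlt
    · have : θ ((2 : ℝ) : AddCircle (2:ℝ)) = 0 := by rw [θ_coe]; norm_num
      simp [this]
    · have : ⌊y / 2⌋ = 0 := by
        rw [Int.floor_eq_iff]; push_cast; constructor <;> linarith [hy.1]
      rw [θ_coe, this]
      simp
  have h2 : pr ⁻¹' S0 ∩ (Set.Ioc 0 (0 + 2) ×ˢ Set.Ioc 0 (0 + 2)) =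
      Set.Ioo (0 : ℝ) 1 ×ˢ Set.Ioo (0 : ℝ) 1 := by
    ext z
    constructor
    · rintro ⟨hz, hz1, hz2⟩
      exact ⟨(hθ _ hz1).1 hz.1, (hθ _ hz2).1 hz.2⟩
    · rintro ⟨hz1, hz2⟩
      have hI : Set.Ioo (0 : ℝ) 1 ⊆ Set.Ioc 0 (0 + 2) := fun y hy => ⟨hy.1, by linarith [hy.2]⟩
      exact ⟨⟨(hθ _ (hI hz1)).2 hz1, (hθ _ (hI hz2)).2 hz2⟩, hI hz1, hI hz2⟩
  rw [h1, ← (measurePreserving_pr 0 0).measure_preimage measurableSet_S0.nullMeasurableSet,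
    Measure.restrict_apply (continuous_pr.measurable measurableSet_S0), h2,
    Measure.volume_eq_prod, Measure.prod_prod, Real.volume_Ioo]
  simp

lemma preimage_frequently (W : Set 𝕋) :
    H ⁻¹' {ζ | ∃ᶠ n in atTop, H^[n] ζ ∈ W} = {ζ | ∃ᶠ n in atTop, H^[n] ζ ∈ W} := by
  ext ζ
  change (∃ᶠ n in atTop, H^[n + 1] ζ ∈ W) ↔ ∃ᶠ n in atTop, H^[n] ζ ∈ W
  conv_rhs => rw [← map_add_atTop_eq_nat 1, frequently_map]

lemma iterate_mem_of_preimage_retMap_eq {s : Set 𝕋} (hs : retMap H ⁻¹' s = s) (k : ℕ) :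
    ∀ ζ ∈ s, H^[k] ζ ∈ S → H^[k] ζ ∈ s := by
  induction k using Nat.strong_induction_on with
  | _ k ih =>
    intro ζ hζ hk
    rcases Nat.eq_zero_or_pos k with rfl | hpos
    · exact hζ
    · have h1 := rtn_spec ⟨k, hpos, hk⟩
      have h2 := rtn_le hpos hk
      have h3 : H^[k] ζ = H^[k - rtn H ζ] (retMap H ζ) := by
        rw [retMap, ← Function.iterate_add_apply, Nat.sub_add_cancel h2]
      rw [h3] at hk ⊢
      refine ih _ (by omega) _ ?_ hk
      rwa [← Set.mem_preimage, hs]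

lemma volume_inter_S_eq_zero {W : Set 𝕋} (hW : MeasurableSet W) (hWS : W ⊆ S)
    (h : volume ({ζ | ∃ᶠ n in atTop, H^[n] ζ ∈ W} ∩ S0) = 0) : volume W = 0 := by
  have h1 : volume {ζ | ¬ (ζ ∈ W → ∃ᶠ n in atTop, H^[n] ζ ∈ W)} = 0 :=
    ae_iff.1 (ae_frequently_mem hW)
  refine measure_mono_null (fun ζ hζ => ?_)
    (measure_union_null (measure_union_null h volume_S_diff_S0) h1)
  by_cases h0 : ζ ∈ S0
  · by_cases hf : ∃ᶠ n in atTop, H^[n] ζ ∈ W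
    · exact Or.inl (Or.inl ⟨hf, h0⟩)
    · exact Or.inr fun h' => hf (h' hζ)
  · exact Or.inl (Or.inr ⟨hWS hζ, h0⟩)

lemma preErgodic_retMap : PreErgodic (retMap H) ((volume : Measure 𝕋).restrict S) := by
  refine ⟨fun s hs hinv => eventuallyConst_set'.2 ?_⟩
  have hm1 : MeasurableSet (s ∩ S) := hs.inter measurableSet_S
  have hm2 : MeasurableSet (sᶜ ∩ S) := hs.compl.inter measurableSet_S
  have hd : Disjoint {ζ | ∃ᶠ n in atTop, H^[n] ζ ∈ s ∩ S}
      {ζ | ∃ᶠ n in atTop, H^[n] ζ ∈ sᶜ ∩ S} := by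
    refine Set.disjoint_left.2 fun ζ h1 h2 => ?_
    obtain ⟨a, ha⟩ := h1.exists
    obtain ⟨b, hab, hb⟩ := frequently_atTop.1 h2 a
    obtain ⟨k, rfl⟩ := Nat.exists_eq_add_of_le' hab
    rw [Function.iterate_add_apply] at hb
    exact hb.1 (iterate_mem_of_preimage_retMap_eq hinv k _ ha.1 hb.2)
  rcases volume_inter_S0_eq_zero_of_disjoint (measurableSet_frequently hm1)
    (measurableSet_frequently hm2) (preimage_frequently _) (preimage_frequently _) hd with h | h
  · refine Or.inl (ae_eq_empty.2 ?_)
    rw [Measure.restrict_apply hs]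
    exact volume_inter_S_eq_zero hm1 Set.inter_subset_right h
  · refine Or.inr (ae_eq_univ.2 ?_)
    rw [Measure.restrict_apply hs.compl]
    exact volume_inter_S_eq_zero hm2 Set.inter_subset_right h

/-- The first-return map of `H` to `S` preserves `μ.restrict S` (a probability measure,
since `μ S = 1`) and is ergodic with respect to it. -/
theorem returnMap_measurePreserving_ergodic :
    (volume : Measure 𝕋) S = 1 ∧
    MeasurePreserving (retMap H) ((volume : Measure 𝕋).restrict S)
      ((volume : Measure 𝕋).restrict S) ∧
    Ergodic (retMap H) ((volume : Measure 𝕋).restrict S) :=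
  ⟨volume_S, measurePreserving_retMap, ⟨measurePreserving_retMap, preErgodic_retMap⟩⟩
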